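/- Fix a tidy (H,𝒫)-graph G with m = |𝒫| in which every path P ∈ 𝒫 has at least 8m vertices. Given any contraction sequence C_H of H, there exists a partial contraction sequence of G of width at most max(w(C_H) + 1, 4) ending in a G-tidy trigraph G' whose part H' consists of a single vertex. -/

import Mathlib

attribute [local instance] Classical.propDecidable

open Finset

universe u

/-- A trigraph: a finite graph whose edge set is partitioned into black and red edges. -/
structure Trigraph (V : Type u) where
  verts : Finset V
  black : Finset (Sym2 V)
  red : Finset (Sym2 V)
  black_nodiag : ∀ e ∈ black, ¬ e.IsDiag
  red_nodiag : ∀ e ∈ red, ¬ e.IsDiag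
  black_support : ∀ e ∈ black, ∀ x ∈ e, x ∈ verts
  red_support : ∀ e ∈ red, ∀ x ∈ e, x ∈ verts
  disj : Disjoint black red

namespace Trigraph

variable {V : Type u}

def BlackAdj (G : Trigraph V) (x y : V) : Prop := s(x, y) ∈ G.black
def RedAdj (G : Trigraph V) (x y : V) : Prop := s(x, y) ∈ G.red
def Adj (G : Trigraph V) (x y : V) : Prop := G.BlackAdj x y ∨ G.RedAdj x y

noncomputable def redDeg (G : Trigraph V) (x : V) : ℕ := (G.red.filter (fun e => x ∈ e)).card
noncomputable def blackDeg (G : Trigraph V) (x : V) : ℕ := (G.black.filter (fun e => x ∈ e)).card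
noncomputable def deg (G : Trigraph V) (x : V) : ℕ :=
  ((G.black ∪ G.red).filter (fun e => x ∈ e)).card
noncomputable def maxRedDeg (G : Trigraph V) : ℕ := G.verts.sup G.redDeg

/-- The black edges after contracting `v` into `u`. -/
noncomputable def cBlack (G : Trigraph V) (u v : V) : Finset (Sym2 V) :=
  G.black.filter (fun e => u ∉ e ∧ v ∉ e) ∪
    ((G.verts.erase v).filter
      (fun y => y ≠ u ∧ s(u, y) ∈ G.black ∧ s(v, y) ∈ G.black)).image (fun y => s(u, y))

/-- The red edges after contracting `v` into `u`. -/
noncomputable def cRed (G : Trigraph V) (u v : V) : Finset (Sym2 V) :=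
  G.red.filter (fun e => u ∉ e ∧ v ∉ e) ∪
    ((G.verts.erase v).filter
      (fun y => y ≠ u ∧ ¬(s(u, y) ∈ G.black ∧ s(v, y) ∈ G.black) ∧
        (s(u, y) ∈ G.red ∨ s(v, y) ∈ G.red ∨
          ¬((s(u, y) ∈ G.black) ↔ (s(v, y) ∈ G.black))))).image (fun y => s(u, y))

/-- Contraction of the two distinct vertices `u, v` of `G`: `v` is removed, `u` becomes the
new merged vertex; a black edge survives towards a common black neighbor, and a red edge is
created towards any other remaining neighbor of `u` or `v`. If `u = v` or one of them is not a
vertex, `G` is returned unchanged. -/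
noncomputable def contract (G : Trigraph V) (u v : V) : Trigraph V :=
  if h : u ≠ v ∧ u ∈ G.verts ∧ v ∈ G.verts then
    { verts := G.verts.erase v
      black := cBlack G u v
      red := cRed G u v
      black_nodiag := by
        intro e he
        rcases Finset.mem_union.1 he with he | he
        · exact G.black_nodiag e (Finset.mem_filter.1 he).1
        · obtain ⟨y, hy, rfl⟩ := Finset.mem_image.1 he
          have hyu : y ≠ u := ((Finset.mem_filter.1 hy).2).1
          simpa [Sym2.isDiag_iff_proj_eq] using fun hh => hyu (Eq.symm hh)
      red_nodiag := by
        intro e he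
        rcases Finset.mem_union.1 he with he | he
        · exact G.red_nodiag e (Finset.mem_filter.1 he).1
        · obtain ⟨y, hy, rfl⟩ := Finset.mem_image.1 he
          have hyu : y ≠ u := ((Finset.mem_filter.1 hy).2).1
          simpa [Sym2.isDiag_iff_proj_eq] using fun hh => hyu (Eq.symm hh)
      black_support := by
        intro e he x hx
        rcases Finset.mem_union.1 he with he | he
        · rcases Finset.mem_filter.1 he with ⟨heb, hu, hv⟩
          refine Finset.mem_erase.2 ⟨?_, G.black_support e heb x hx⟩
          rintro rfl; exact hv hx
        · obtain ⟨y, hy, rfl⟩ := Finset.mem_image.1 he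
          rcases Sym2.mem_iff.1 hx with rfl | rfl
          · exact Finset.mem_erase.2 ⟨h.1.symm ∘ Eq.symm, h.2.1⟩
          · exact (Finset.mem_filter.1 hy).1
      red_support := by
        intro e he x hx
        rcases Finset.mem_union.1 he with he | he
        · rcases Finset.mem_filter.1 he with ⟨heb, hu, hv⟩
          refine Finset.mem_erase.2 ⟨?_, G.red_support e heb x hx⟩
          rintro rfl; exact hv hx
        · obtain ⟨y, hy, rfl⟩ := Finset.mem_image.1 he
          rcases Sym2.mem_iff.1 hx with rfl | rfl
          · exact Finset.mem_erase.2 ⟨h.1.symm ∘ Eq.symm, h.2.1⟩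
          · exact (Finset.mem_filter.1 hy).1
      disj := by
        rw [Finset.disjoint_left]
        intro e heb her
        rcases Finset.mem_union.1 heb with heb | heb <;>
          rcases Finset.mem_union.1 her with her | her
        · exact Finset.disjoint_left.1 G.disj (Finset.mem_filter.1 heb).1
            (Finset.mem_filter.1 her).1
        · obtain ⟨y, hy, hey⟩ := Finset.mem_image.1 her
          exact ((Finset.mem_filter.1 heb).2).1 (hey ▸ Sym2.mem_mk_left u y)
        · obtain ⟨y, hy, hey⟩ := Finset.mem_image.1 heb
          exact ((Finset.mem_filter.1 her).2).1 (hey ▸ Sym2.mem_mk_left u y)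
        · obtain ⟨y, hy, hey⟩ := Finset.mem_image.1 heb
          obtain ⟨y', hy', hey'⟩ := Finset.mem_image.1 her
          have : y = y' := Sym2.congr_right.1 (hey.trans hey'.symm)
          subst this
          exact (((Finset.mem_filter.1 hy').2).2).1 ((Finset.mem_filter.1 hy).2).2 }
  else G

/-- The trigraph obtained from `G` by performing the contractions recorded in `ps`
(each pair `(u, v)` contracts `v` into `u`). -/
noncomputable def stage (G : Trigraph V) (ps : List (V × V)) : Trigraph V :=
  ps.foldl (fun H p => H.contract p.1 p.2) G

/-- The list `ps` records genuine contractions (distinct current vertices) starting from `G`. -/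
noncomputable def ValidSteps : Trigraph V → List (V × V) → Prop
  | _, [] => True
  | G, p :: ps =>
      p.1 ≠ p.2 ∧ p.1 ∈ G.verts ∧ p.2 ∈ G.verts ∧ ValidSteps (G.contract p.1 p.2) ps

/-- `ps` encodes a (complete) contraction sequence of `G`, ending in a one-vertex trigraph. -/
noncomputable def IsContractionSeq (G : Trigraph V) (ps : List (V × V)) : Prop :=
  ValidSteps G ps ∧ (stage G ps).verts.card = 1

/-- The width of the (partial) contraction sequence of `G` encoded by `ps`: the maximum red
degree appearing in any of its trigraphs. -/
noncomputable def seqWidth (G : Trigraph V) (ps : List (V × V)) : ℕ :=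
  ((List.range (ps.length + 1)).map (fun j => (stage G (ps.take j)).maxRedDeg)).foldr max 0

/-- The twin-width of a trigraph: the minimum width of a contraction sequence. -/
noncomputable def tww (G : Trigraph V) : ℕ :=
  sInf {t | ∃ ps, G.IsContractionSeq ps ∧ G.seqWidth ps ≤ t}

/-- Where the original vertex `x` currently lives after the contractions in `ps`. -/
noncomputable def collapse (ps : List (V × V)) (x : V) : V :=
  ps.foldl (fun y p => if y = p.2 then p.1 else y) x

/-- The bag of a vertex `u` after the contractions in `ps`: all original vertices of `G`
contracted into `u`. -/
noncomputable def bag (G : Trigraph V) (ps : List (V × V)) (u : V) : Finset V :=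
  G.verts.filter (fun x => collapse ps x = u)

/-- The induced subtrigraph on a vertex set `Q`. -/
noncomputable def induce (G : Trigraph V) (Q : Finset V) : Trigraph V where
  verts := G.verts ∩ Q
  black := G.black.filter (fun e => ∀ x ∈ e, x ∈ Q)
  red := G.red.filter (fun e => ∀ x ∈ e, x ∈ Q)
  black_nodiag := fun e he => G.black_nodiag e (Finset.mem_filter.1 he).1
  red_nodiag := fun e he => G.red_nodiag e (Finset.mem_filter.1 he).1
  black_support := fun e he x hx =>
    Finset.mem_inter.2 ⟨G.black_support e (Finset.mem_filter.1 he).1 x hx,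
      (Finset.mem_filter.1 he).2 x hx⟩
  red_support := fun e he x hx =>
    Finset.mem_inter.2 ⟨G.red_support e (Finset.mem_filter.1 he).1 x hx,
      (Finset.mem_filter.1 he).2 x hx⟩
  disj := Finset.disjoint_filter_filter G.disj

/-- The underlying simple graph of a trigraph (ignoring colors). -/
def toSimple (G : Trigraph V) : SimpleGraph V :=
  SimpleGraph.fromEdgeSet ↑(G.black ∪ G.red)

/-- A trigraph is connected if it is nonempty and all pairs of its vertices are joined by paths. -/
def Conn (G : Trigraph V) : Prop :=
  G.verts.Nonempty ∧ ∀ x ∈ G.verts, ∀ y ∈ G.verts, G.toSimple.Reachable x y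

/-- Distance from a vertex `x` to a set `A` of vertices. -/
noncomputable def distToSet (G : Trigraph V) (A : Finset V) (x : V) : ℕ :=
  sInf {d | ∃ a ∈ A, G.toSimple.dist x a = d}

end Trigraph

namespace Trigraph

variable {V : Type u}

/-- A dangling red path in `G`: a nonempty list of distinct vertices of `G`, with consecutive
vertices joined by red edges, in which every vertex has degree 2 in `G`. -/
def IsDanglingRedPath (G : Trigraph V) (p : List V) : Prop :=
  p ≠ [] ∧ p.Nodup ∧ p.Chain' G.RedAdj ∧ ∀ x ∈ p, x ∈ G.verts ∧ G.deg x = 2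

/-- `G` is a tidy `(H, 𝒫)`-graph (Definition 5): `G` is connected with `tww(G) ≥ 2`, `𝒫` is a
nonempty set of pairwise disjoint dangling red paths, `H` (given by its vertex set `HV`) and
the disjoint union `⊔𝒫` are disjoint induced subtrigraphs covering all of `G`, and every
vertex of `H` with a neighbor in `⊔𝒫` has black degree 0 and exactly that one neighbor
in `⊔𝒫`. -/
structure IsTidy (G : Trigraph V) (HV : Finset V) (P : Finset (List V)) : Prop where
  conn : G.Conn
  tww_ge : 2 ≤ G.tww
  Pne : P.Nonempty
  paths : ∀ p ∈ P, G.IsDanglingRedPath p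
  pathsDisj : ∀ p ∈ P, ∀ q ∈ P, p ≠ q → ∀ x ∈ p, x ∉ q
  Hsub : HV ⊆ G.verts
  Hdisj : ∀ p ∈ P, ∀ x ∈ p, x ∉ HV
  cover : ∀ x ∈ G.verts, x ∈ HV ∨ ∃ p ∈ P, x ∈ p
  pathsInduced : ∀ p ∈ P, ∀ x ∈ p, ∀ y ∈ p, G.Adj x y → ([x, y] <:+: p ∨ [y, x] <:+: p)
  noPathPathEdges : ∀ p ∈ P, ∀ q ∈ P, p ≠ q → ∀ x ∈ p, ∀ y ∈ q, ¬ G.Adj x y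
  boundary : ∀ u ∈ HV, ∀ v, (∃ p ∈ P, v ∈ p) → G.Adj u v →
    G.blackDeg u = 0 ∧ ∀ w, (∃ p ∈ P, w ∈ p) → G.Adj u w → w = v

/-- The part `H'` of a trigraph obtained from `G` by the contractions `ps`: the vertices
whose bag is contained in `HV`. -/
noncomputable def Hpart (G : Trigraph V) (HV : Finset V) (ps : List (V × V)) : Finset V :=
  (stage G ps).verts.filter (fun u => bag G ps u ⊆ HV)

/-- The vertex set of `F`: the vertices outside `H` at distance at most `2m` from `H`. -/
noncomputable def Fverts (G : Trigraph V) (HV : Finset V) (m : ℕ) : Finset V :=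
  (G.verts \ HV).filter (fun x => G.distToSet HV x ≤ 2 * m)

/-- The part `F'` of a trigraph obtained from `G` by the contractions `ps`: the vertices
whose bag is contained in `V(F)`. -/
noncomputable def Fpart (G : Trigraph V) (HV : Finset V) (m : ℕ) (ps : List (V × V)) :
    Finset V :=
  (stage G ps).verts.filter (fun u => bag G ps u ⊆ Fverts G HV m)

/-- The level of a vertex: the (common) distance from `H` in `G` of the vertices in its bag. -/
noncomputable def level (G : Trigraph V) (HV : Finset V) (ps : List (V × V)) (u : V) : ℕ :=
  sInf {d | ∃ x ∈ bag G ps u, G.distToSet HV x = d}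

/-- The connected component of `u` in the forest `F'`. -/
noncomputable def Fcomp (G : Trigraph V) (HV : Finset V) (m : ℕ) (ps : List (V × V)) (u : V) :
    Finset V :=
  (Fpart G HV m ps).filter
    (fun w => ((stage G ps).induce (Fpart G HV m ps)).toSimple.Reachable u w)

/-- The degree-3 vertices of the component of `u` in `F'`. -/
noncomputable def Fcomp3 (G : Trigraph V) (HV : Finset V) (m : ℕ) (ps : List (V × V)) (u : V) :
    Finset V :=
  (Fcomp G HV m ps u).filter (fun w => (stage G ps).deg w = 3)

/-- The trigraph reached from `G` by the contractions `ps` is `G`-tidy (Definition 7), for a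
tidy `(H, 𝒫)`-graph `G` with `m = |𝒫|`. -/
structure IsGTidy (G : Trigraph V) (HV : Finset V) (m : ℕ) (ps : List (V × V)) : Prop where
  valid : ValidSteps G ps
  basic : ∀ u ∈ (stage G ps).verts,
      u ∈ Hpart G HV ps ∨ u ∈ Fpart G HV m ps ∨ (bag G ps u).card = 1
  outs : ∀ u ∈ Hpart G HV ps,
      (((stage G ps).verts \ Hpart G HV ps).filter (fun v => (stage G ps).Adj u v)).card ≤ 1
  levels : ∀ u ∈ Fpart G HV m ps, ∀ x ∈ bag G ps u, ∀ y ∈ bag G ps u,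
      G.distToSet HV x = G.distToSet HV y
  forest : ((stage G ps).induce (Fpart G HV m ps)).toSimple.IsAcyclic
  deg_le : ∀ u ∈ Fpart G HV m ps, (stage G ps).deg u ≤ 3
  comp_cond : ∀ u ∈ Fpart G HV m ps,
      ∃ r ∈ Fcomp G HV m ps u, level G HV ps r = 1 ∧
        (∀ r' ∈ Fcomp G HV m ps u, level G HV ps r' = 1 → r' = r) ∧
        (∀ a ∈ Fcomp3 G HV m ps u, ∀ b ∈ Fcomp3 G HV m ps u,
          ((stage G ps).induce (Fcomp3 G HV m ps u)).toSimple.Reachable a b) ∧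
        (∀ w ∈ Fcomp3 G HV m ps u, level G HV ps w ≤ (bag G ps r).card - 1) ∧
        (Fcomp3 G HV m ps u = ∅ ∨ r ∈ Fcomp3 G HV m ps u)

end Trigraph

open Trigraph

namespace Trigraph

variable {V : Type u}

theorem BlackAdj.symm {G : Trigraph V} {x y : V} (h : G.BlackAdj x y) : G.BlackAdj y x := by
  unfold BlackAdj at *; rwa [Sym2.eq_swap]

theorem RedAdj.symm {G : Trigraph V} {x y : V} (h : G.RedAdj x y) : G.RedAdj y x := by
  unfold RedAdj at *; rwa [Sym2.eq_swap]

theorem Adj.symm {G : Trigraph V} {x y : V} (h : G.Adj x y) : G.Adj y x :=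
  h.imp BlackAdj.symm RedAdj.symm

theorem BlackAdj.not_redAdj {G : Trigraph V} {x y : V} (h : G.BlackAdj x y) : ¬ G.RedAdj x y :=
  fun h' => Finset.disjoint_left.1 G.disj h h'

theorem Adj.ne {G : Trigraph V} {x y : V} (h : G.Adj x y) : x ≠ y := by
  rintro rfl
  rcases h with h | h
  · exact G.black_nodiag _ h (by simp)
  · exact G.red_nodiag _ h (by simp)

theorem Adj.left_mem {G : Trigraph V} {x y : V} (h : G.Adj x y) : x ∈ G.verts := by
  rcases h with h | h
  · exact G.black_support _ h x (by simp)
  · exact G.red_support _ h x (by simp)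

theorem Adj.right_mem {G : Trigraph V} {x y : V} (h : G.Adj x y) : y ∈ G.verts :=
  h.symm.left_mem

theorem redAdj_iff {G : Trigraph V} {x y : V} : G.RedAdj x y ↔ G.Adj x y ∧ ¬ G.BlackAdj x y :=
  ⟨fun h => ⟨Or.inr h, fun hb => hb.not_redAdj h⟩, fun h => h.1.resolve_left h.2⟩

theorem toSimple_adj {G : Trigraph V} {x y : V} : G.toSimple.Adj x y ↔ G.Adj x y := by
  simp only [toSimple, SimpleGraph.fromEdgeSet_adj]
  constructor
  · rintro ⟨h, -⟩
    simpa [Adj, BlackAdj, RedAdj] using h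
  · intro h
    exact ⟨by simpa [Adj, BlackAdj, RedAdj] using h, h.ne⟩

theorem induce_adj {G : Trigraph V} {Q : Finset V} {x y : V} :
    (G.induce Q).Adj x y ↔ G.Adj x y ∧ x ∈ Q ∧ y ∈ Q := by
  simp [Adj, BlackAdj, RedAdj, induce]; tauto

theorem induce_blackAdj {G : Trigraph V} {Q : Finset V} {x y : V} :
    (G.induce Q).BlackAdj x y ↔ G.BlackAdj x y ∧ x ∈ Q ∧ y ∈ Q := by
  simp [BlackAdj, induce]

/-- The edges of `E` at `x` are counted by the neighbors of `x`. -/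
theorem exists_card_edges_eq (E : Finset (Sym2 V)) (x : V) :
    ∃ S : Finset V, S.card = (E.filter (fun e => x ∈ e)).card ∧ ∀ y, y ∈ S ↔ s(x, y) ∈ E := by
  have key : ∀ e ∈ E.filter (fun e => x ∈ e), ∃ y, s(x, y) = e := by
    intro e he
    obtain ⟨y, hy⟩ := Sym2.mem_iff_exists.1 (Finset.mem_filter.1 he).2
    exact ⟨y, hy.symm⟩
  have : Nonempty V := ⟨x⟩
  choose! g hg using key
  have hS : ∀ y, y ∈ (E.filter (fun e => x ∈ e)).image g ↔ s(x, y) ∈ E := by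
    intro y
    constructor
    · intro hy
      obtain ⟨e, he, rfl⟩ := Finset.mem_image.1 hy
      rw [hg e he]
      exact (Finset.mem_filter.1 he).1
    · intro hy
      have hm : s(x, y) ∈ E.filter (fun e => x ∈ e) := by simp [hy]
      exact Finset.mem_image.2 ⟨_, hm, Sym2.congr_right.1 (hg _ hm)⟩
  refine ⟨_, Finset.card_image_of_injOn ?_, hS⟩
  intro e he e' he' h
  rw [← hg e he, ← hg e' he', h]

theorem exists_redNeighbors (G : Trigraph V) (x : V) :
    ∃ S : Finset V, S.card = G.redDeg x ∧ ∀ y, y ∈ S ↔ G.RedAdj x y :=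
  exists_card_edges_eq G.red x

theorem exists_neighbors (G : Trigraph V) (x : V) :
    ∃ S : Finset V, S.card = G.deg x ∧ ∀ y, y ∈ S ↔ G.Adj x y := by
  obtain ⟨S, h1, h2⟩ := exists_card_edges_eq (G.black ∪ G.red) x
  exact ⟨S, h1, fun y => by rw [h2]; simp [Adj, BlackAdj, RedAdj]⟩

theorem redDeg_le_card {G : Trigraph V} {x : V} (S : Finset V) (h : ∀ y, G.RedAdj x y → y ∈ S) :
    G.redDeg x ≤ S.card := by
  obtain ⟨T, h1, h2⟩ := G.exists_redNeighbors x
  rw [← h1]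
  exact Finset.card_le_card fun y hy => h y ((h2 y).1 hy)

theorem deg_le_card {G : Trigraph V} {x : V} (S : Finset V) (h : ∀ y, G.Adj x y → y ∈ S) :
    G.deg x ≤ S.card := by
  obtain ⟨T, h1, h2⟩ := G.exists_neighbors x
  rw [← h1]
  exact Finset.card_le_card fun y hy => h y ((h2 y).1 hy)

theorem card_le_deg {G : Trigraph V} {x : V} (S : Finset V) (h : ∀ y ∈ S, G.Adj x y) :
    S.card ≤ G.deg x := by
  obtain ⟨T, h1, h2⟩ := G.exists_neighbors x
  rw [← h1]
  exact Finset.card_le_card fun y hy => (h2 y).2 (h y hy)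

theorem contract_verts {G : Trigraph V} {u v : V} (h : u ≠ v ∧ u ∈ G.verts ∧ v ∈ G.verts) :
    (G.contract u v).verts = G.verts.erase v := by
  simp [contract, h]

/-- The map on vertices describing the contraction of `v` into `u`. -/
noncomputable def mergeInto (u v y : V) : V := if y = v then u else y

theorem contract_verts_eq_image {G : Trigraph V} {u v : V}
    (h : u ≠ v ∧ u ∈ G.verts ∧ v ∈ G.verts) :
    (G.contract u v).verts = G.verts.image (mergeInto u v) := by
  rw [contract_verts h]
  ext y
  simp only [mem_erase, mem_image, mergeInto]
  grind

theorem contract_blackAdj {G : Trigraph V} {u v : V} (h : u ≠ v ∧ u ∈ G.verts ∧ v ∈ G.verts)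
    {x y : V} (hx : x ∈ (G.contract u v).verts) (hy : y ∈ (G.contract u v).verts) (hxy : x ≠ y) :
    (G.contract u v).BlackAdj x y ↔
      ∀ x' ∈ G.verts, ∀ y' ∈ G.verts, mergeInto u v x' = x → mergeInto u v y' = y →
        G.BlackAdj x' y' := by
  rw [contract_verts h] at hx hy
  have hb : (G.contract u v).BlackAdj x y ↔ s(x, y) ∈ cBlack G u v := by
    simp [contract, h, BlackAdj]
  have hs : s(x, y) = s(y, x) := Sym2.eq_swap
  rw [hb]
  simp only [cBlack, mem_union, mem_filter, mem_image, mem_erase, Sym2.mem_iff, not_or,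
    Sym2.eq_iff] at *
  have sw : ∀ a b : V, s(a, b) ∈ G.black → s(b, a) ∈ G.black := fun a b hab => by
    rwa [Sym2.eq_swap]
  simp only [mergeInto, BlackAdj]
  constructor
  · rintro (h1 | ⟨z, h1, h2⟩) x' hx' y' hy' h3 h4 <;> grind
  · intro h1
    by_cases hxu : x = u
    · right; exact ⟨y, by grind⟩
    by_cases hyu : y = u
    · right; exact ⟨x, by grind⟩
    left; grind

theorem contract_adj {G : Trigraph V} {u v : V} (h : u ≠ v ∧ u ∈ G.verts ∧ v ∈ G.verts)
    {x y : V} (hx : x ∈ (G.contract u v).verts) (hy : y ∈ (G.contract u v).verts) (hxy : x ≠ y) :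
    (G.contract u v).Adj x y ↔
      ∃ x' ∈ G.verts, ∃ y' ∈ G.verts, mergeInto u v x' = x ∧ mergeInto u v y' = y ∧
        G.Adj x' y' := by
  rw [contract_verts h] at hx hy
  have hb : (G.contract u v).Adj x y ↔ s(x, y) ∈ cBlack G u v ∨ s(x, y) ∈ cRed G u v := by
    simp [contract, h, Adj, BlackAdj, RedAdj]
  have hs : s(x, y) = s(y, x) := Sym2.eq_swap
  rw [hb]
  simp only [cBlack, cRed, mem_union, mem_filter, mem_image, mem_erase, Sym2.mem_iff, not_or,
    Sym2.eq_iff] at *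
  have sw : ∀ a b : V, s(a, b) ∈ G.black → s(b, a) ∈ G.black := fun a b hab => by
    rwa [Sym2.eq_swap]
  have sw' : ∀ a b : V, s(a, b) ∈ G.red → s(b, a) ∈ G.red := fun a b hab => by
    rwa [Sym2.eq_swap]
  simp only [mergeInto, Adj, BlackAdj, RedAdj]
  constructor
  · rintro ((h1 | ⟨z, h1, h2⟩) | (h1 | ⟨z, h1, h2⟩))
    · exact ⟨x, by grind, y, by grind⟩
    · rcases h2 with ⟨rfl, rfl⟩ | ⟨rfl, rfl⟩
      · exact ⟨u, by grind, z, by grind⟩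
      · exact ⟨z, by grind, u, by grind⟩
    · exact ⟨x, by grind, y, by grind⟩
    · have : (s(u, z) ∈ G.black ∨ s(u, z) ∈ G.red) ∨ (s(v, z) ∈ G.black ∨ s(v, z) ∈ G.red) := by
        grind
      rcases this with h3 | h3 <;> rcases h2 with ⟨rfl, rfl⟩ | ⟨rfl, rfl⟩
      · exact ⟨u, by grind, z, by grind⟩
      · exact ⟨z, by grind, u, by grind⟩
      · exact ⟨v, by grind, z, by grind⟩
      · exact ⟨z, by grind, v, by grind⟩
  · rintro ⟨x', hx', y', hy', h1, h2, h3⟩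
    by_cases hxu : x = u
    · by_cases hz : s(u, y) ∈ G.black ∧ s(v, y) ∈ G.black
      · left; right; exact ⟨y, by grind⟩
      · right; right; exact ⟨y, by grind⟩
    by_cases hyu : y = u
    · by_cases hz : s(u, x) ∈ G.black ∧ s(v, x) ∈ G.black
      · left; right; exact ⟨x, by grind⟩
      · right; right; exact ⟨x, by grind⟩
    rcases h3 with h3 | h3
    · left; left; grind
    · right; left; grind

theorem stage_append (G : Trigraph V) (ps : List (V × V)) (p : V × V) :
    stage G (ps ++ [p]) = (stage G ps).contract p.1 p.2 := by
  simp [stage]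

theorem collapse_append (ps : List (V × V)) (p : V × V) (x : V) :
    collapse (ps ++ [p]) x = mergeInto p.1 p.2 (collapse ps x) := by
  simp only [collapse, List.foldl_append]; rfl

theorem validSteps_append (G : Trigraph V) (ps : List (V × V)) (p : V × V) :
    ValidSteps G (ps ++ [p]) ↔ ValidSteps G ps ∧
      (p.1 ≠ p.2 ∧ p.1 ∈ (stage G ps).verts ∧ p.2 ∈ (stage G ps).verts) := by
  induction ps generalizing G with
  | nil => simp [ValidSteps, stage]
  | cons q ps ih =>
    simp only [List.cons_append, ValidSteps, ih]
    simp only [stage, List.foldl_cons]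
    tauto

theorem stage_verts {G : Trigraph V} {ps : List (V × V)} (hv : ValidSteps G ps) :
    (stage G ps).verts = G.verts.image (collapse ps) := by
  induction ps using List.reverseRecOn with
  | nil => ext x; simp [stage, collapse]
  | append_singleton ps p ih =>
    rw [validSteps_append] at hv
    rw [stage_append, contract_verts_eq_image hv.2, ih hv.1, Finset.image_image]
    congr 1
    ext x
    rw [collapse_append]; rfl

theorem collapse_mem {G : Trigraph V} {ps : List (V × V)} (hv : ValidSteps G ps) {x : V}
    (hx : x ∈ G.verts) : collapse ps x ∈ (stage G ps).verts := by
  rw [stage_verts hv]; exact Finset.mem_image_of_mem _ hx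

theorem stage_blackAdj {G : Trigraph V} {ps : List (V × V)} (hv : ValidSteps G ps)
    {x y : V} (hx : x ∈ G.verts) (hy : y ∈ G.verts) (hxy : collapse ps x ≠ collapse ps y) :
    (stage G ps).BlackAdj (collapse ps x) (collapse ps y) ↔
      ∀ x' ∈ G.verts, ∀ y' ∈ G.verts, collapse ps x' = collapse ps x →
        collapse ps y' = collapse ps y → G.BlackAdj x' y' := by
  induction ps using List.reverseRecOn generalizing x y with
  | nil => simp [stage, collapse]; grind
  | append_singleton ps p ih =>
    have hx1 := collapse_mem hv hx
    have hy1 := collapse_mem hv hy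
    rw [validSteps_append] at hv
    rw [stage_append] at hx1 hy1 ⊢
    rw [contract_blackAdj hv.2 hx1 hy1 hxy, stage_verts hv.1]
    simp only [Finset.forall_mem_image]
    constructor
    · intro h x' hx' y' hy' h1 h2
      have h3 : collapse ps x' ≠ collapse ps y' := by
        intro h4
        exact hxy (by rw [← h1, ← h2, collapse_append, collapse_append, h4])
      rw [collapse_append] at h1 h2
      exact (ih hv.1 hx' hy' h3).1 (h hx' hy' h1 h2) x' hx' y' hy' rfl rfl
    · intro h x' hx' y' hy' h1 h2
      rw [← collapse_append] at h1 h2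
      have h3 : collapse ps x' ≠ collapse ps y' := by
        intro h4
        exact hxy (by rw [← h1, ← h2, collapse_append, collapse_append, h4])
      refine (ih hv.1 hx' hy' h3).2 fun x'' hx'' y'' hy'' h4 h5 => ?_
      refine h x'' hx'' y'' hy'' ?_ ?_
      · rw [← h1, collapse_append, collapse_append, h4]
      · rw [← h2, collapse_append, collapse_append, h5]

theorem stage_adj {G : Trigraph V} {ps : List (V × V)} (hv : ValidSteps G ps)
    {x y : V} (hx : x ∈ G.verts) (hy : y ∈ G.verts) (hxy : collapse ps x ≠ collapse ps y) :
    (stage G ps).Adj (collapse ps x) (collapse ps y) ↔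
      ∃ x' ∈ G.verts, ∃ y' ∈ G.verts, collapse ps x' = collapse ps x ∧
        collapse ps y' = collapse ps y ∧ G.Adj x' y' := by
  induction ps using List.reverseRecOn generalizing x y with
  | nil =>
    simp only [stage, collapse, List.foldl_nil]
    exact ⟨fun h => ⟨x, hx, y, hy, rfl, rfl, h⟩, by rintro ⟨_, _, _, _, rfl, rfl, h⟩; exact h⟩
  | append_singleton ps p ih =>
    have hx1 := collapse_mem hv hx
    have hy1 := collapse_mem hv hy
    rw [validSteps_append] at hv
    rw [stage_append] at hx1 hy1 ⊢
    rw [contract_adj hv.2 hx1 hy1 hxy, stage_verts hv.1]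
    constructor
    · rintro ⟨X, hX, Y, hY, h1, h2, h⟩
      obtain ⟨x', hx', rfl⟩ := Finset.mem_image.1 hX
      obtain ⟨y', hy', rfl⟩ := Finset.mem_image.1 hY
      obtain ⟨x'', hx'', y'', hy'', h4, h5, h6⟩ := (ih hv.1 hx' hy' h.ne).1 h
      refine ⟨x'', hx'', y'', hy'', ?_, ?_, h6⟩
      · rw [collapse_append, h4, h1]
      · rw [collapse_append, h5, h2]
    · rintro ⟨x', hx', y', hy', h1, h2, h⟩
      have h3 : collapse ps x' ≠ collapse ps y' := by
        intro h4
        exact hxy (by rw [← h1, ← h2, collapse_append, collapse_append, h4])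
      refine ⟨_, Finset.mem_image_of_mem _ hx', _, Finset.mem_image_of_mem _ hy', ?_, ?_,
        (ih hv.1 hx' hy' h3).2 ⟨x', hx', y', hy', rfl, rfl, h⟩⟩
      · rw [← collapse_append, h1]
      · rw [← collapse_append, h2]

theorem seqWidth_le_iff (G : Trigraph V) (ps : List (V × V)) (D : ℕ) :
    G.seqWidth ps ≤ D ↔ ∀ j ≤ ps.length, (stage G (ps.take j)).maxRedDeg ≤ D := by
  have key : ∀ l : List ℕ, l.foldr max 0 ≤ D ↔ ∀ a ∈ l, a ≤ D := by
    intro l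
    induction l with
    | nil => simp
    | cons a l ih => simp [ih]
  rw [seqWidth, key]
  simp only [List.mem_map, List.mem_range, forall_exists_index, and_imp, forall_apply_eq_imp_iff₂,
    Nat.lt_succ_iff]

end Trigraph

namespace Trigraph

variable {V : Type u}

/-- The classes of `x` and `y` are joined by a red edge, or are equal, in the quotient of `G`
by `Q`. -/
def QuotRed (G : Trigraph V) (Q : Setoid V) (x y : V) : Prop :=
  (∃ x' y', Q x' x ∧ Q y' y ∧ G.Adj x' y') ∧
    ∃ x' ∈ G.verts, ∃ y' ∈ G.verts, Q x' x ∧ Q y' y ∧ ¬ G.BlackAdj x' y'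

/-- In the quotient of `G` by `Q`, every vertex has red degree at most `D`. -/
def Narrow (G : Trigraph V) (Q : Setoid V) (D : ℕ) : Prop :=
  ∀ x ∈ G.verts, ∃ S : Finset V, S.card ≤ D ∧
    ∀ y ∈ G.verts, ¬ Q x y → QuotRed G Q x y → ∃ s ∈ S, s ∈ G.verts ∧ Q y s

/-- The bags after the contractions in `ps` are the classes of `Q`. -/
def Realizes (G : Trigraph V) (ps : List (V × V)) (Q : Setoid V) : Prop :=
  ValidSteps G ps ∧ ∀ x ∈ G.verts, ∀ y ∈ G.verts, collapse ps x = collapse ps y ↔ Q x y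

theorem Realizes.redAdj_iff {G : Trigraph V} {ps : List (V × V)} {Q : Setoid V}
    (h : Realizes G ps Q) {x y : V} (hx : x ∈ G.verts) (hy : y ∈ G.verts) (hxy : ¬ Q x y) :
    (stage G ps).RedAdj (collapse ps x) (collapse ps y) ↔ QuotRed G Q x y := by
  have hne : collapse ps x ≠ collapse ps y := fun e => hxy ((h.2 x hx y hy).1 e)
  rw [Trigraph.redAdj_iff, stage_adj h.1 hx hy hne, stage_blackAdj h.1 hx hy hne]
  push Not
  refine and_congr ?_ ?_
  · constructor
    · rintro ⟨x', hx', y', hy', h1, h2, h3⟩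
      exact ⟨x', y', (h.2 _ hx' _ hx).1 h1, (h.2 _ hy' _ hy).1 h2, h3⟩
    · rintro ⟨x', y', h1, h2, h3⟩
      exact ⟨x', h3.left_mem, y', h3.right_mem, (h.2 _ h3.left_mem _ hx).2 h1,
        (h.2 _ h3.right_mem _ hy).2 h2, h3⟩
  · constructor
    · rintro ⟨x', hx', y', hy', h1, h2, h3⟩
      exact ⟨x', hx', y', hy', (h.2 _ hx' _ hx).1 h1, (h.2 _ hy' _ hy).1 h2, h3⟩
    · rintro ⟨x', hx', y', hy', h1, h2, h3⟩
      exact ⟨x', hx', y', hy', (h.2 _ hx' _ hx).2 h1, (h.2 _ hy' _ hy).2 h2, h3⟩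

theorem Realizes.maxRedDeg_le_iff {G : Trigraph V} {ps : List (V × V)} {Q : Setoid V}
    (h : Realizes G ps Q) (D : ℕ) : (stage G ps).maxRedDeg ≤ D ↔ Narrow G Q D := by
  rw [maxRedDeg, Finset.sup_le_iff, stage_verts h.1, Finset.forall_mem_image]
  refine forall₂_congr fun x hx => ?_
  constructor
  · intro hD
    obtain ⟨T, hT, hT'⟩ := (stage G ps).exists_redNeighbors (collapse ps x)
    have hmem : ∀ t ∈ T, ∃ y ∈ G.verts, collapse ps y = t := by
      intro t ht
      have : t ∈ (stage G ps).verts := Adj.right_mem (Or.inr ((hT' t).1 ht))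
      rw [stage_verts h.1] at this
      exact Finset.mem_image.1 this
    have : Nonempty V := ⟨x⟩
    choose! g hg using hmem
    refine ⟨T.image g, (Finset.card_image_le.trans hT.le).trans hD, fun y hy hxy hr => ?_⟩
    have hyT := (hT' _).2 ((h.redAdj_iff hx hy hxy).2 hr)
    exact ⟨_, Finset.mem_image_of_mem _ hyT, (hg _ hyT).1,
      (h.2 _ hy _ (hg _ hyT).1).1 (hg _ hyT).2.symm⟩
  · rintro ⟨S, hS, hS'⟩
    refine (redDeg_le_card (S.image (collapse ps)) fun t ht => ?_).trans
      (Finset.card_image_le.trans hS)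
    have htm : t ∈ (stage G ps).verts := Adj.right_mem (Or.inr ht)
    rw [stage_verts h.1] at htm
    obtain ⟨y, hy, rfl⟩ := Finset.mem_image.1 htm
    have hxy : ¬ Q x y := fun e => (Adj.ne (Or.inr ht)) ((h.2 _ hx _ hy).2 e)
    obtain ⟨s, hs, hsv, hys⟩ := hS' y hy hxy ((h.redAdj_iff hx hy hxy).1 ht)
    exact Finset.mem_image.2 ⟨s, hs, (h.2 _ hsv _ hy).2 (Q.symm' hys)⟩

/-- The coarsening of `Q` that merges the classes of `a` and `b`. -/
def glue (Q : Setoid V) (a b : V) : Setoid V where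
  r x y := Q x y ∨ (Q x a ∧ Q y b) ∨ (Q x b ∧ Q y a)
  iseqv :=
    { refl := fun x => Or.inl (Q.refl' x)
      symm := by
        rintro x y (h | h | h)
        · exact Or.inl (Q.symm' h)
        · exact Or.inr (Or.inr h.symm)
        · exact Or.inr (Or.inl h.symm)
      trans := by
        intro x y z h1 h2
        have t := @Q.trans'
        have s := @Q.symm'
        grind }

theorem glue_apply {Q : Setoid V} {a b x y : V} :
    glue Q a b x y ↔ Q x y ∨ (Q x a ∧ Q y b) ∨ (Q x b ∧ Q y a) := Iff.rfl

theorem Realizes.glue {G : Trigraph V} {ps : List (V × V)} {Q : Setoid V}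
    (h : Realizes G ps Q) {a b : V} (ha : a ∈ G.verts) (hb : b ∈ G.verts) (hab : ¬ Q a b) :
    Realizes G (ps ++ [(collapse ps a, collapse ps b)]) (glue Q a b) := by
  have hne : collapse ps a ≠ collapse ps b := fun e => hab ((h.2 a ha b hb).1 e)
  refine ⟨(validSteps_append _ _ _).2 ⟨h.1, hne, collapse_mem h.1 ha, collapse_mem h.1 hb⟩, ?_⟩
  intro x hx y hy
  rw [collapse_append, collapse_append, glue_apply, ← h.2 x hx y hy, ← h.2 x hx a ha,
    ← h.2 x hx b hb, ← h.2 y hy a ha, ← h.2 y hy b hb]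
  simp only [mergeInto]
  grind

/-- Some contraction sequence of width at most `D` leads from `G` to its quotient by `Q`. -/
def Reach (G : Trigraph V) (D : ℕ) (Q : Setoid V) : Prop :=
  ∃ ps, Realizes G ps Q ∧ G.seqWidth ps ≤ D

theorem seqWidth_append_le {G : Trigraph V} {ps : List (V × V)} {p : V × V} {D : ℕ}
    (h1 : G.seqWidth ps ≤ D) (h2 : (stage G (ps ++ [p])).maxRedDeg ≤ D) :
    G.seqWidth (ps ++ [p]) ≤ D := by
  rw [seqWidth_le_iff] at *
  intro j hj
  rcases Nat.lt_or_ge ps.length j with hlt | hle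
  · rw [List.take_of_length_le (by simp; omega)]
    exact h2
  · rw [List.take_append_of_le_length hle]
    exact h1 j hle

/-- If every coarsening of `Q` that refines `R` is narrow, then `R` can be reached from `Q`. -/
theorem Reach.of_le {G : Trigraph V} {D : ℕ} {Q R : Setoid V} (h : Reach G D Q) (hQR : Q ≤ R)
    (hn : ∀ Q' : Setoid V, Q ≤ Q' → Q' ≤ R → Narrow G Q' D) : Reach G D R := by
  induction hN : ((G.verts ×ˢ G.verts).filter fun p => R p.1 p.2 ∧ ¬ Q p.1 p.2).card using
    Nat.strong_induction_on generalizing Q with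
  | _ N ih =>
    obtain ⟨ps, hps, hw⟩ := h
    by_cases hall : ∀ x ∈ G.verts, ∀ y ∈ G.verts, R x y → Q x y
    · exact ⟨ps, ⟨hps.1, fun x hx y hy =>
        (hps.2 x hx y hy).trans ⟨fun e => hQR e, hall x hx y hy⟩⟩, hw⟩
    push Not at hall
    obtain ⟨a, ha, b, hb, hR, hQ⟩ := hall
    have hle : Q ≤ glue Q a b := fun {x y} e => Or.inl e
    have hge : glue Q a b ≤ R := by
      rintro x y (e | ⟨e1, e2⟩ | ⟨e1, e2⟩)
      · exact hQR e
      · exact R.trans' (hQR e1) (R.trans' hR (R.symm' (hQR e2)))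
      · exact R.trans' (hQR e1) (R.trans' (R.symm' hR) (R.symm' (hQR e2)))
    have hgl := hps.glue ha hb hQ
    refine ih _ ?_ ⟨_, hgl, seqWidth_append_le hw ((hgl.maxRedDeg_le_iff D).2
      (hn _ hle hge))⟩ hge (fun Q' h1 h2 => hn Q' (hle.trans h1) h2) rfl
    rw [← hN]
    apply Finset.card_lt_card
    rw [Finset.ssubset_iff_of_subset]
    · refine ⟨(a, b), by simp [ha, hb, hR, hQ], ?_⟩
      simp only [mem_filter, not_and, not_not]
      exact fun _ _ => Or.inr (Or.inl ⟨Q.refl' a, Q.refl' b⟩)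
    · intro p hp
      simp only [mem_filter] at hp ⊢
      exact ⟨hp.1, hp.2.1, fun e => hp.2.2 (hle e)⟩

end Trigraph

namespace Trigraph

variable {V : Type u}

/-- The legs of a tidy `(H, 𝒫)`-graph: for `a : ι`, the vertices `f a 0, f a 1, …, f a (N + 1)`
form a path leaving `H`, whose first vertex is in `H` and whose `i`-th vertex is at
distance `i` from `H`. -/
structure Legs (G : Trigraph V) (HV : Finset V) (N : ℕ) {ι : Type u} [Fintype ι]
    (f : ι → ℕ → V) : Prop where
  two_le : 2 ≤ N
  card_le : Fintype.card ι ≤ N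
  sub : HV ⊆ G.verts
  inj : ∀ {a b i j}, i ≤ N + 1 → j ≤ N + 1 → f a i = f b j → a = b ∧ i = j
  zero : ∀ a, f a 0 ∈ HV
  mem : ∀ a i, i ≤ N → f a (i + 1) ∈ G.verts ∧ f a (i + 1) ∉ HV
  adj : ∀ a i y, i < N → (G.Adj (f a (i + 1)) y ↔ y = f a i ∨ y = f a (i + 2))
  out : ∀ {x y}, x ∈ HV → y ∉ HV → G.Adj x y → ∃ a, x = f a 0 ∧ y = f a 1
  deg_two : ∀ {x}, x ∈ G.verts → x ∉ HV → ∃ y z, ∀ w, G.Adj x w → w = y ∨ w = z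

/-- Nontrivial classes of `Q` lie in `H` or on one level of the legs. -/
def Leveled (HV : Finset V) (N : ℕ) {ι : Type u} (f : ι → ℕ → V) (Q : Setoid V) : Prop :=
  ∀ x y, Q x y → x = y ∨ (x ∈ HV ∧ y ∈ HV) ∨
    ∃ i a b, i < N ∧ x = f a (i + 1) ∧ y = f b (i + 1)

variable {G : Trigraph V} {HV : Finset V} {N : ℕ} {ι : Type u} [Fintype ι] {f : ι → ℕ → V}

theorem Leveled.mem_iff {Q : Setoid V} (hQ : Leveled HV N f Q) (hf : Legs G HV N f) {x y : V}
    (h : Q x y) : x ∈ HV ↔ y ∈ HV := by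
  rcases hQ x y h with rfl | ⟨h1, h2⟩ | ⟨i, a, b, hi, rfl, rfl⟩
  · rfl
  · simp [h1, h2]
  · simp [(hf.mem a i hi.le).2, (hf.mem b i hi.le).2]

theorem Leveled.mem_verts {Q : Setoid V} (hQ : Leveled HV N f Q) (hf : Legs G HV N f) {x y : V}
    (h : Q x y) (hx : x ∈ G.verts) : y ∈ G.verts := by
  rcases hQ x y h with rfl | ⟨h1, h2⟩ | ⟨i, a, b, hi, rfl, rfl⟩
  · exact hx
  · exact hf.sub h2
  · exact (hf.mem b i hi.le).1

theorem Leveled.exists_eq {Q : Setoid V} (hQ : Leveled HV N f Q) (hf : Legs G HV N f) {y : V}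
    {a : ι} {i : ℕ} (hi : i ≤ N) (h : Q (f a (i + 1)) y) :
    ∃ b, y = f b (i + 1) := by
  rcases hQ _ y h with rfl | ⟨h1, h2⟩ | ⟨j, c, b, hj, h1, rfl⟩
  · exact ⟨a, rfl⟩
  · exact absurd h1 (hf.mem a i hi).2
  · obtain ⟨-, h2⟩ := hf.inj (by omega) (by omega) h1
    exact ⟨b, by rw [h2]⟩

/-- A partition met while merging two tidy components: every vertex on a leg has at most
two neighbors above and at most two below, with at most three in total except at level one. -/
structure Thin (HV : Finset V) (N : ℕ) (f : ι → ℕ → V) (Q : Setoid V) : Prop where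
  leveled : Leveled HV N f Q
  zero_one : ∀ a b, Q (f a 0) (f b 0) → Q (f a 1) (f b 1)
  one_zero : ∀ a b c, Q (f a 1) (f b 1) → Q (f a 1) (f c 1) →
    Q (f a 0) (f b 0) ∨ Q (f a 0) (f c 0) ∨ Q (f b 0) (f c 0)
  down : ∀ i a b, 1 ≤ i → i < N → Q (f a (i + 1)) (f b (i + 1)) → Q (f a i) (f b i)
  split : ∀ i a b c, 1 ≤ i → i ≤ N → Q (f a i) (f b i) → Q (f a i) (f c i) →
    Q (f a (i + 1)) (f b (i + 1)) ∨ Q (f a (i + 1)) (f c (i + 1)) ∨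
      Q (f b (i + 1)) (f c (i + 1))

theorem exists_pair {α : Type*} {E : Setoid V} {g : α → V} {C : α → Prop} {a : α} (ha : C a)
    (h : ∀ b c, C b → C c → E (g a) (g b) ∨ E (g a) (g c) ∨ E (g b) (g c)) :
    ∃ b c, C b ∧ C c ∧ ∀ d, C d → E (g d) (g b) ∨ E (g d) (g c) := by
  by_cases hall : ∀ d, C d → E (g a) (g d)
  · exact ⟨a, a, ha, ha, fun d hd => Or.inl (E.symm' (hall d hd))⟩
  · push Not at hall
    obtain ⟨b, hb, hab⟩ := hall
    refine ⟨a, b, ha, hb, fun d hd => ?_⟩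
    rcases h b d hb hd with h | h | h
    · exact absurd h hab
    · exact Or.inl (E.symm' h)
    · exact Or.inr (E.symm' h)

theorem Narrow.congr {K : Trigraph V} {Q Q' : Setoid V} {D : ℕ}
    (h : ∀ x ∈ K.verts, ∀ y ∈ K.verts, Q x y ↔ Q' x y) (hn : Narrow K Q D) : Narrow K Q' D := by
  intro x hx
  obtain ⟨S, hS, hS'⟩ := hn x hx
  refine ⟨S, hS, fun y hy hxy hr => ?_⟩
  obtain ⟨s, hs, hsv, hys⟩ := hS' y hy (fun e => hxy ((h x hx y hy).1 e)) (by
    obtain ⟨⟨x1, y1, h1, h2, h3⟩, x2, hx2, y2, hy2, h4, h5, h6⟩ := hr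
    exact ⟨⟨x1, y1, (h _ h3.left_mem _ hx).2 h1, (h _ h3.right_mem _ hy).2 h2, h3⟩, x2, hx2, y2,
      hy2, (h _ hx2 _ hx).2 h4, (h _ hy2 _ hy).2 h5, h6⟩)
  exact ⟨s, hs, hsv, (h _ hy _ hsv).1 hys⟩

theorem Leveled.quotRed_induce {Q : Setoid V} (hQ : Leveled HV N f Q) (hf : Legs G HV N f)
    {x y : V} (hx : x ∈ HV) (hy : y ∈ HV) (h : QuotRed G Q x y) :
    QuotRed (G.induce HV) Q x y := by
  obtain ⟨⟨x1, y1, h1, h2, h3⟩, x2, hx2, y2, hy2, h4, h5, h6⟩ := h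
  have m := fun {x y} => @Leveled.mem_iff V G HV N ι _ f Q hQ hf x y
  refine ⟨⟨x1, y1, h1, h2, induce_adj.2 ⟨h3, (m h1).2 hx, (m h2).2 hy⟩⟩, x2, ?_, y2, ?_, h4, h5,
    fun hb => h6 (induce_blackAdj.1 hb).1⟩
  · exact Finset.mem_inter.2 ⟨hx2, (m h4).2 hx⟩
  · exact Finset.mem_inter.2 ⟨hy2, (m h5).2 hy⟩

theorem Thin.narrow {Q : Setoid V} (hQ : Thin HV N f Q) (hf : Legs G HV N f) {w : ℕ}
    (hH : Narrow (G.induce HV) Q w) : Narrow G Q (max (w + 1) 4) := by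
  have hl := hQ.leveled
  have four : ∀ {x : V} (s1 s2 s3 s4 : V), (∀ y ∈ G.verts, ¬ Q x y →
      (∃ x' y', Q x' x ∧ Q y' y ∧ G.Adj x' y') → Q y s1 ∨ Q y s2 ∨ Q y s3 ∨ Q y s4) →
      ∃ S : Finset V, S.card ≤ max (w + 1) 4 ∧
        ∀ y ∈ G.verts, ¬ Q x y → QuotRed G Q x y → ∃ s ∈ S, s ∈ G.verts ∧ Q y s := by
    intro x s1 s2 s3 s4 h
    refine ⟨{s1, s2, s3, s4}, (Finset.card_le_four).trans (le_max_right _ _),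
      fun y hy hxy hr => ?_⟩
    rcases h y hy hxy hr.1 with h | h | h | h
    · exact ⟨s1, by simp, hl.mem_verts hf h hy, h⟩
    · exact ⟨s2, by simp, hl.mem_verts hf h hy, h⟩
    · exact ⟨s3, by simp, hl.mem_verts hf h hy, h⟩
    · exact ⟨s4, by simp, hl.mem_verts hf h hy, h⟩
  intro x hx
  by_cases hxH : x ∈ HV
  · obtain ⟨S, hS, hS'⟩ := hH x (Finset.mem_inter.2 ⟨hx, hxH⟩)
    have hin : ∀ y ∈ HV, ¬ Q x y → QuotRed G Q x y → ∃ s ∈ S, s ∈ G.verts ∧ Q y s := by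
      intro y hy hxy hr
      obtain ⟨s, hs, hsv, hys⟩ := hS' y (Finset.mem_inter.2 ⟨hf.sub hy, hy⟩) hxy
        (hl.quotRed_induce hf hxH hy hr)
      exact ⟨s, hs, (Finset.mem_inter.1 hsv).1, hys⟩
    have hout : ∀ y ∉ HV, QuotRed G Q x y → ∃ a, Q (f a 0) x ∧ Q (f a 1) y := by
      rintro y hy ⟨⟨x1, y1, h1, h2, h3⟩, -⟩
      obtain ⟨a, rfl, rfl⟩ := hf.out ((hl.mem_iff hf h1).2 hxH)
        (fun h => hy ((hl.mem_iff hf h2).1 h)) h3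
      exact ⟨a, h1, h2⟩
    by_cases hex : ∃ a, Q (f a 0) x
    · obtain ⟨a, ha⟩ := hex
      refine ⟨insert (f a 1) S, (Finset.card_insert_le _ _).trans
        (le_max_of_le_left (by omega)), fun y hy hxy hr => ?_⟩
      by_cases hyH : y ∈ HV
      · obtain ⟨s, hs, h⟩ := hin y hyH hxy hr
        exact ⟨s, Finset.mem_insert_of_mem hs, h⟩
      · obtain ⟨b, hb, hb'⟩ := hout y hyH hr
        refine ⟨f a 1, Finset.mem_insert_self _ _, (hf.mem a 0 (by omega)).1, ?_⟩
        exact Q.trans' (Q.symm' hb') (hQ.zero_one _ _ (Q.trans' hb (Q.symm' ha)))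
    · refine ⟨S, hS.trans (le_max_of_le_left (by omega)), fun y hy hxy hr => ?_⟩
      by_cases hyH : y ∈ HV
      · exact hin y hyH hxy hr
      · obtain ⟨b, hb, -⟩ := hout y hyH hr
        exact absurd ⟨b, hb⟩ hex
  by_cases hleg : ∃ i a, i < N ∧ x = f a (i + 1)
  · obtain ⟨i, a, hi, rfl⟩ := hleg
    obtain ⟨b, c, hb, hc, hbc⟩ := exists_pair (E := Q) (g := fun d => f d (i + 2))
      (C := fun d => Q (f a (i + 1)) (f d (i + 1))) (a := a) (Q.refl' _)
      (fun b c hb hc => hQ.split (i + 1) a b c (by omega) (by omega) hb hc)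
    obtain ⟨d, e, hde⟩ : ∃ d e, ∀ c, Q (f a (i + 1)) (f c (i + 1)) →
        Q (f c i) (f d i) ∨ Q (f c i) (f e i) := by
      rcases Nat.eq_zero_or_pos i with rfl | hi0
      · obtain ⟨d, e, -, -, h⟩ := exists_pair (E := Q) (g := fun d => f d 0)
          (C := fun d => Q (f a 1) (f d 1)) (a := a) (Q.refl' _)
          (fun b c hb hc => hQ.one_zero a b c hb hc)
        exact ⟨d, e, h⟩
      · exact ⟨a, a, fun c hc => Or.inl (Q.symm' (hQ.down i a c hi0 hi hc))⟩
    refine four (f b (i + 2)) (f c (i + 2)) (f d i) (f e i) ?_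
    rintro y hy - ⟨x', y', h1, h2, h3⟩
    obtain ⟨k, rfl⟩ := hl.exists_eq hf hi.le (Q.symm' h1)
    have t : ∀ {z}, Q y' z → Q y z := fun h => Q.trans' (Q.symm' h2) h
    rcases (hf.adj k i y' hi).1 h3 with rfl | rfl
    · rcases hde k (Q.symm' h1) with h | h
      · exact Or.inr (Or.inr (Or.inl (t h)))
      · exact Or.inr (Or.inr (Or.inr (t h)))
    · rcases hbc k (Q.symm' h1) with h | h
      · exact Or.inl (t h)
      · exact Or.inr (Or.inl (t h))
  · obtain ⟨s, t, hst⟩ := hf.deg_two hx hxH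
    refine four s t s t ?_
    rintro y hy - ⟨x', y', h1, h2, h3⟩
    have hxx : x' = x := by
      rcases hl _ _ h1 with h | h | ⟨i, a, b, hi, h, h'⟩
      · exact h
      · exact absurd h.2 hxH
      · exact absurd ⟨i, b, hi, h'⟩ hleg
    subst hxx
    rcases hst y' h3 with rfl | rfl
    · exact Or.inl (Q.symm' h2)
    · exact Or.inr (Or.inl (Q.symm' h2))

/-- The partitions corresponding to `G`-tidy trigraphs. -/
structure TidyPart (HV : Finset V) (N : ℕ) (f : ι → ℕ → V) (Q : Setoid V) : Prop where
  leveled : Leveled HV N f Q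
  zero_one : ∀ a b, Q (f a 0) (f b 0) → Q (f a 1) (f b 1)
  down : ∀ i a b, i < N → Q (f a (i + 1)) (f b (i + 1)) → Q (f a i) (f b i)
  split : ∀ i a b c, 1 ≤ i → i ≤ N → Q (f a i) (f b i) → Q (f a i) (f c i) →
    Q (f a (i + 1)) (f b (i + 1)) ∨ Q (f a (i + 1)) (f c (i + 1)) ∨
      Q (f b (i + 1)) (f c (i + 1))
  parent : ∀ i a b, 1 ≤ i → i < N → Q (f a (i + 1)) (f b (i + 1)) →
    ¬ Q (f a (i + 2)) (f b (i + 2)) → ∃ c, Q (f a i) (f c i) ∧ ¬ Q (f a (i + 1)) (f c (i + 1))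
  size : ∀ i a b, 1 ≤ i → i ≤ N → Q (f a i) (f b i) → a ≠ b →
    i + 1 ≤ (univ.filter fun c => Q (f a 0) (f c 0)).card

theorem TidyPart.thin {Q : Setoid V} (hQ : TidyPart HV N f Q) (hf : Legs G HV N f) :
    Thin HV N f Q where
  leveled := hQ.leveled
  zero_one := hQ.zero_one
  one_zero a b c h _ := Or.inl (hQ.down 0 a b (by have := hf.two_le; omega) h)
  down i a b _ h := hQ.down i a b h
  split := hQ.split

theorem TidyPart.down_zero {Q : Setoid V} (hQ : TidyPart HV N f Q) {i : ℕ} (hi : i ≤ N)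
    {a b : ι} (h : Q (f a i) (f b i)) : Q (f a 0) (f b 0) := by
  induction i with
  | zero => exact h
  | succ i ih => exact ih (by omega) (hQ.down i a b (by omega) h)

theorem tidyPart_bot (hf : Legs G HV N f) : TidyPart HV N f (⊥ : Setoid V) := by
  have key : ∀ {i a b}, i ≤ N + 1 → (⊥ : Setoid V) (f a i) (f b i) → a = b :=
    fun hi h => (hf.inj hi hi h).1
  refine ⟨fun x y h => Or.inl h, ?_, ?_, ?_, ?_, ?_⟩
  · intro a b h
    rw [key (by omega) h]
  · intro i a b hi h
    rw [key (by omega) h]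
  · intro i a b c _ hi h _
    left
    rw [key (by omega) h]
  · intro i a b _ hi h h'
    exact absurd (by rw [key (by omega) h]) h'
  · intro i a b _ hi h h'
    exact absurd (key (by omega) h) h'

end Trigraph

namespace Trigraph

variable {V : Type u}

/-- The leg `a` lies in a component merged with another one when `Q` is coarsened to `R`. -/
def Moved {ι : Type u} (f : ι → ℕ → V) (Q R : Setoid V) (a : ι) : Prop :=
  ∃ b, R (f a 0) (f b 0) ∧ ¬ Q (f a 0) (f b 0)

theorem Moved.of_rel {ι : Type u} {f : ι → ℕ → V} {Q R : Setoid V} {a b : ι} (ha : Moved f Q R a)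
    (h : R (f a 0) (f b 0)) : Moved f Q R b := by
  obtain ⟨c, h1, h2⟩ := ha
  by_cases h3 : Q (f a 0) (f b 0)
  · exact ⟨c, R.trans' (R.symm' h) h1, fun h4 => h2 (Q.trans' h3 h4)⟩
  · exact ⟨a, R.symm' h, fun h4 => h3 (Q.symm' h4)⟩

variable {G : Trigraph V} {HV : Finset V} {N : ℕ} {ι : Type u} [Fintype ι]
  {f : ι → ℕ → V}

/-- `R` merges classes of `Q` inside `H` in pairs. -/
structure Merges (HV : Finset V) (Q R : Setoid V) : Prop where
  le : ∀ {x y}, Q x y → R x y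
  sub : ∀ {x y}, R x y → Q x y ∨ (x ∈ HV ∧ y ∈ HV)
  pairs : ∀ {x y z}, R x y → R x z → Q x y ∨ Q x z ∨ Q y z

theorem Merges.of_leg {Q R : Setoid V} (hR : Merges HV Q R) (hf : Legs G HV N f) {i : ℕ}
    (hi : i ≤ N) {a : ι} {y : V} (h : R (f a (i + 1)) y) : Q (f a (i + 1)) y :=
  (hR.sub h).resolve_right fun h' => (hf.mem a i hi).2 h'.1

variable {Q R : Setoid V}

/-- The partition in which the components to be merged are shifted by one level, from level
`k` on. -/
def shift (hf : Legs G HV N f) (hQ : TidyPart HV N f Q) (hR : Merges HV Q R) (k : ℕ) :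
    Setoid V where
  r x y := Q x y ∨ (k = 0 ∧ R x y) ∨ ∃ i a b, k ≤ i + 1 ∧ i < N ∧ Moved f Q R a ∧
    Moved f Q R b ∧ R (f a i) (f b i) ∧ x = f a (i + 1) ∧ y = f b (i + 1)
  iseqv :=
    { refl := fun x => Or.inl (Q.refl' x)
      symm := by
        rintro x y (h | h | ⟨i, a, b, h1, h2, h3, h4, h5, h6, h7⟩)
        · exact Or.inl (Q.symm' h)
        · exact Or.inr (Or.inl ⟨h.1, R.symm' h.2⟩)
        · exact Or.inr (Or.inr ⟨i, b, a, h1, h2, h4, h3, R.symm' h5, h7, h6⟩)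
      trans := by
        have left : ∀ {x i a}, i < N → Moved f Q R a → Q x (f a (i + 1)) →
            ∃ c, Moved f Q R c ∧ R (f c i) (f a i) ∧ x = f c (i + 1) := by
          intro x i a hi ha h
          obtain ⟨c, rfl⟩ := hQ.leveled.exists_eq hf hi.le (Q.symm' h)
          exact ⟨c, ha.of_rel (hR.le (Q.symm' (hQ.down_zero (by omega) h))),
            hR.le (hQ.down _ _ _ hi h), rfl⟩
        have leftR : ∀ {x i a}, i < N → Moved f Q R a → R x (f a (i + 1)) →
            ∃ c, Moved f Q R c ∧ R (f c i) (f a i) ∧ x = f c (i + 1) := fun hi ha h =>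
          left hi ha (Q.symm' (hR.of_leg hf hi.le (R.symm' h)))
        rintro x y z (h | ⟨h0, h⟩ | ⟨i, a, b, h1, h2, h3, h4, h5, h6, h7⟩)
          (h' | ⟨h0', h'⟩ | ⟨j, c, d, h1', h2', h3', h4', h5', h6', h7'⟩)
        · exact Or.inl (Q.trans' h h')
        · exact Or.inr (Or.inl ⟨h0', R.trans' (hR.le h) h'⟩)
        · subst h6'
          obtain ⟨e, he, he', rfl⟩ := left h2' h3' h
          exact Or.inr (Or.inr ⟨j, e, d, h1', h2', he, h4', R.trans' he' h5', rfl, h7'⟩)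
        · exact Or.inr (Or.inl ⟨h0, R.trans' h (hR.le h')⟩)
        · exact Or.inr (Or.inl ⟨h0, R.trans' h h'⟩)
        · subst h6'
          obtain ⟨e, he, he', rfl⟩ := leftR h2' h3' h
          exact Or.inr (Or.inr ⟨j, e, d, h1', h2', he, h4', R.trans' he' h5', rfl, h7'⟩)
        · subst h7
          obtain ⟨e, he, he', rfl⟩ := left h2 h4 (Q.symm' h')
          exact Or.inr (Or.inr ⟨i, a, e, h1, h2, h3, he, R.trans' h5 (R.symm' he'), h6, rfl⟩)
        · subst h7
          obtain ⟨e, he, he', rfl⟩ := leftR h2 h4 (R.symm' h')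
          exact Or.inr (Or.inr ⟨i, a, e, h1, h2, h3, he, R.trans' h5 (R.symm' he'), h6, rfl⟩)
        · rw [h7] at h6'
          obtain ⟨rfl, hij⟩ := hf.inj (by omega) (by omega) h6'
          obtain rfl : i = j := by omega
          exact Or.inr (Or.inr ⟨i, a, d, h1, h2, h3, h4', R.trans' h5 h5', h6, h7'⟩) }

section

variable (hf : Legs G HV N f) (hQ : TidyPart HV N f Q) (hR : Merges HV Q R)

theorem shift_apply {k : ℕ} {x y : V} : shift hf hQ hR k x y ↔
    Q x y ∨ (k = 0 ∧ R x y) ∨ ∃ i a b, k ≤ i + 1 ∧ i < N ∧ Moved f Q R a ∧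
    Moved f Q R b ∧ R (f a i) (f b i) ∧ x = f a (i + 1) ∧ y = f b (i + 1) := Iff.rfl

theorem shift_of_mem {k : ℕ} {x y : V} (hx : x ∈ HV) :
    shift hf hQ hR k x y ↔ Q x y ∨ (k = 0 ∧ R x y) := by
  rw [shift_apply]
  constructor
  · rintro (h | h | ⟨i, a, b, h1, h2, h3, h4, h5, rfl, rfl⟩)
    · exact Or.inl h
    · exact Or.inr h
    · exact absurd hx (hf.mem a i h2.le).2
  · exact fun h => h.elim Or.inl fun h => Or.inr (Or.inl h)

theorem shift_leg {k i : ℕ} (hi : i < N) {a b : ι} :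
    shift hf hQ hR k (f a (i + 1)) (f b (i + 1)) ↔ Q (f a (i + 1)) (f b (i + 1)) ∨
      (k ≤ i + 1 ∧ Moved f Q R a ∧ Moved f Q R b ∧ R (f a i) (f b i)) := by
  rw [shift_apply]
  constructor
  · rintro (h | h | ⟨j, c, d, h1, h2, h3, h4, h5, h6, h7⟩)
    · exact Or.inl h
    · exact Or.inl (hR.of_leg hf hi.le h.2)
    · obtain ⟨rfl, h⟩ := hf.inj (by omega) (by omega) h6
      obtain ⟨rfl, -⟩ := hf.inj (by omega) (by omega) h7
      obtain rfl : i = j := by omega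
      exact Or.inr ⟨h1, h3, h4, h5⟩
  · rintro (h | ⟨h1, h2, h3, h4⟩)
    · exact Or.inl h
    · exact Or.inr (Or.inr ⟨i, a, b, h1, hi, h2, h3, h4, rfl, rfl⟩)

theorem shift_leveled (k : ℕ) : Leveled HV N f (shift hf hQ hR k) := by
  rintro x y (h | h | ⟨i, a, b, h1, h2, h3, h4, h5, h6, h7⟩)
  · exact hQ.leveled x y h
  · rcases hR.sub h.2 with h | h
    · exact hQ.leveled x y h
    · exact Or.inr (Or.inl h)
  · exact Or.inr (Or.inr ⟨i, a, b, h2, h6, h7⟩)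

theorem shift_succ_le (k : ℕ) : shift hf hQ hR (k + 1) ≤ shift hf hQ hR k := by
  rintro x y (h | h | ⟨i, a, b, h1, h⟩)
  · exact Or.inl h
  · exact absurd h.1 (by omega)
  · exact Or.inr (Or.inr ⟨i, a, b, by omega, h⟩)

theorem rel_of_shift_leg {k i : ℕ} (hi : i < N) {a b : ι}
    (h : shift hf hQ hR k (f a (i + 1)) (f b (i + 1))) : R (f a i) (f b i) := by
  rcases (shift_leg hf hQ hR hi).1 h with h | h
  · exact hR.le (hQ.down i a b hi h)
  · exact h.2.2.2

theorem shift_one_of_rel {a b : ι} (h : R (f a 0) (f b 0)) {k : ℕ} (hk : k ≤ 1) :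
    shift hf hQ hR k (f a 1) (f b 1) := by
  by_cases h' : Q (f a 0) (f b 0)
  · exact Or.inl (hQ.zero_one a b h')
  · exact (shift_leg hf hQ hR (by have := hf.two_le; omega)).2
      (Or.inr ⟨hk, ⟨b, h, h'⟩, ⟨a, R.symm' h, fun h'' => h' (Q.symm' h'')⟩, h⟩)

include hR in
theorem card_lt_of_moved {a : ι} (ha : Moved f Q R a) :
    (univ.filter fun c => Q (f a 0) (f c 0)).card <
      (univ.filter fun c => R (f a 0) (f c 0)).card := by
  obtain ⟨b, h1, h2⟩ := ha
  apply Finset.card_lt_card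
  rw [Finset.ssubset_iff_of_subset]
  · exact ⟨b, by simp [h1], by simp [h2]⟩
  · intro c hc
    simp only [mem_filter, mem_univ, true_and] at hc ⊢
    exact hR.le hc

include hf hQ hR in
/-- In a component that gets merged, the classes at the last but one level are trivial. -/
theorem eq_of_moved {a b : ι} (ha : Moved f Q R a) {i : ℕ} (hi : i + 1 = N)
    (h : R (f a i) (f b i)) : a = b := by
  by_contra hab
  have h2 := hf.two_le
  obtain ⟨j, rfl⟩ : ∃ j, i = j + 1 := ⟨i - 1, by omega⟩
  have hs := hQ.size (j + 1) a b (by omega) (by omega) (hR.of_leg hf (by omega) h) hab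
  have hlt := card_lt_of_moved hR ha
  have hc : (univ.filter fun c => R (f a 0) (f c 0)).card ≤ Fintype.card ι := Finset.card_le_univ _
  have := hf.card_le
  omega

theorem shift_split {k i : ℕ} (h1 : 1 ≤ i) (hi : i ≤ N) {a b c : ι}
    (hab : shift hf hQ hR k (f a i) (f b i)) (hac : shift hf hQ hR k (f a i) (f c i)) :
    shift hf hQ hR (k + 1) (f a (i + 1)) (f b (i + 1)) ∨
      shift hf hQ hR (k + 1) (f a (i + 1)) (f c (i + 1)) ∨
      shift hf hQ hR (k + 1) (f b (i + 1)) (f c (i + 1)) := by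
  obtain ⟨i, rfl⟩ : ∃ j, i = j + 1 := ⟨i - 1, by omega⟩
  by_cases hm : k ≤ i + 1 ∧ Moved f Q R a
  swap
  · have aux : ∀ {d}, shift hf hQ hR k (f a (i + 1)) (f d (i + 1)) →
        Q (f a (i + 1)) (f d (i + 1)) := fun h =>
      ((shift_leg hf hQ hR (by omega)).1 h).resolve_right fun h' => hm ⟨h'.1, h'.2.1⟩
    rcases hQ.split (i + 1) a b c h1 hi (aux hab) (aux hac) with h | h | h
    · exact Or.inl (Or.inl h)
    · exact Or.inr (Or.inl (Or.inl h))
    · exact Or.inr (Or.inr (Or.inl h))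
  obtain ⟨hk, hm⟩ := hm
  have moved : ∀ {d}, shift hf hQ hR k (f a (i + 1)) (f d (i + 1)) → Moved f Q R d := by
    intro d h
    rcases (shift_leg hf hQ hR (by omega)).1 h with h | h
    · exact hm.of_rel (hR.le (hQ.down_zero (by omega) h))
    · exact h.2.2.1
  have hab' := rel_of_shift_leg hf hQ hR (by omega) hab
  have hac' := rel_of_shift_leg hf hQ hR (by omega) hac
  rcases Nat.lt_or_ge (i + 1) N with hlt | hge
  · have hs : Q (f a (i + 1)) (f b (i + 1)) ∨ Q (f a (i + 1)) (f c (i + 1)) ∨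
        Q (f b (i + 1)) (f c (i + 1)) := by
      rcases Nat.eq_zero_or_pos i with rfl | hpos
      · rcases hR.pairs hab' hac' with h | h | h
        · exact Or.inl (hQ.zero_one _ _ h)
        · exact Or.inr (Or.inl (hQ.zero_one _ _ h))
        · exact Or.inr (Or.inr (hQ.zero_one _ _ h))
      · obtain ⟨i, rfl⟩ : ∃ j, i = j + 1 := ⟨i - 1, by omega⟩
        exact hQ.split (i + 1) a b c hpos (by omega) (hR.of_leg hf (by omega) hab')
          (hR.of_leg hf (by omega) hac')
    have conv : ∀ {d e}, Moved f Q R d → Moved f Q R e → Q (f d (i + 1)) (f e (i + 1)) →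
        shift hf hQ hR (k + 1) (f d (i + 2)) (f e (i + 2)) := fun hd he h =>
      (shift_leg hf hQ hR hlt).2 (Or.inr ⟨by omega, hd, he, hR.le h⟩)
    exact hs.imp (conv hm (moved hab)) (Or.imp (conv hm (moved hac))
      (conv (moved hab) (moved hac)))
  · left
    rw [eq_of_moved hf hQ hR hm (by omega) hab']

theorem shift_between_thin {k : ℕ} {Q' : Setoid V} (h1 : shift hf hQ hR (k + 1) ≤ Q')
    (h2 : Q' ≤ shift hf hQ hR k) : Thin HV N f Q' where
  leveled x y h := shift_leveled hf hQ hR k x y (h2 h)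
  zero_one a b h := by
    rcases (shift_of_mem hf hQ hR (hf.zero a)).1 (h2 h) with h | ⟨rfl, h⟩
    · exact h1 (Or.inl (hQ.zero_one a b h))
    · exact h1 (shift_one_of_rel hf hQ hR h (by omega))
  one_zero a b c hab hac := by
    have hN : 0 < N := by have := hf.two_le; omega
    have := hR.pairs (rel_of_shift_leg hf hQ hR hN (h2 hab)) (rel_of_shift_leg hf hQ hR hN (h2 hac))
    exact this.imp (fun h => h1 (Or.inl h)) (Or.imp (fun h => h1 (Or.inl h))
      fun h => h1 (Or.inl h))
  down i a b hi hi' h := by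
    obtain ⟨i, rfl⟩ : ∃ j, i = j + 1 := ⟨i - 1, by omega⟩
    exact h1 (Or.inl (hR.of_leg hf (by omega) (rel_of_shift_leg hf hQ hR hi' (h2 h))))
  split i a b c hi hi' hab hac :=
    (shift_split hf hQ hR hi hi' (h2 hab) (h2 hac)).imp (fun h => h1 h)
      (Or.imp (fun h => h1 h) fun h => h1 h)

theorem shift_zero_tidyPart : TidyPart HV N f (shift hf hQ hR 0) where
  leveled := shift_leveled hf hQ hR 0
  zero_one a b h := by
    rcases (shift_of_mem hf hQ hR (hf.zero a)).1 h with h | ⟨-, h⟩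
    · exact Or.inl (hQ.zero_one a b h)
    · exact shift_one_of_rel hf hQ hR h (by omega)
  down i a b hi h := Or.inr (Or.inl ⟨rfl, rel_of_shift_leg hf hQ hR hi h⟩)
  split i a b c hi hi' hab hac :=
    (shift_split hf hQ hR hi hi' hab hac).imp (fun h => shift_succ_le hf hQ hR 0 h)
      (Or.imp (fun h => shift_succ_le hf hQ hR 0 h) fun h => shift_succ_le hf hQ hR 0 h)
  parent i a b hi hi' h h' := by
    obtain ⟨i, rfl⟩ : ∃ j, i = j + 1 := ⟨i - 1, by omega⟩
    by_cases ha : Moved f Q R a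
    swap
    · have hq : Q (f a (i + 1 + 1)) (f b (i + 1 + 1)) :=
        ((shift_leg hf hQ hR hi').1 h).resolve_right fun h => ha h.2.1
      obtain ⟨c, hc, hc'⟩ := hQ.parent (i + 1) a b hi hi' hq fun h => h' (Or.inl h)
      exact ⟨c, Or.inl hc, fun h => hc' (((shift_leg hf hQ hR hi').1 h).resolve_right
        fun h => ha h.2.1)⟩
    have hq : Q (f a (i + 1)) (f b (i + 1)) :=
      hR.of_leg hf (by omega) (rel_of_shift_leg hf hQ hR hi' h)
    have hb : Moved f Q R b := ha.of_rel (hR.le (hQ.down_zero (by omega) hq))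
    have hlt : i + 2 < N := by
      by_contra hge
      obtain rfl := eq_of_moved hf hQ hR ha (by omega) (rel_of_shift_leg hf hQ hR hi' h)
      exact h' (Setoid.refl' _ _)
    have hq' : ¬ Q (f a (i + 2)) (f b (i + 2)) := fun hq' =>
      h' ((shift_leg hf hQ hR hlt).2 (Or.inr ⟨by omega, ha, hb, hR.le hq'⟩))
    obtain ⟨c, hc, hc', hcm⟩ : ∃ c, R (f a i) (f c i) ∧ ¬ Q (f a (i + 1)) (f c (i + 1)) ∧
        Moved f Q R c := by
      rcases Nat.eq_zero_or_pos i with rfl | hpos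
      · obtain ⟨c, hc, hc'⟩ := id ha
        exact ⟨c, hc, fun h => hc' (hQ.down_zero (i := 1) (by omega) h), ha.of_rel hc⟩
      · obtain ⟨c, hc, hc'⟩ := hQ.parent i a b hpos (by omega) hq hq'
        exact ⟨c, hR.le hc, hc', ha.of_rel (hR.le (hQ.down_zero (by omega) hc))⟩
    refine ⟨c, (shift_leg hf hQ hR (by omega)).2 (Or.inr ⟨by omega, ha, hcm, hc⟩), fun h => ?_⟩
    exact hc' (hR.of_leg hf (by omega) (rel_of_shift_leg hf hQ hR hi' h))
  size i a b hi hi' h hab := by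
    have heq : (univ.filter fun c => shift hf hQ hR 0 (f a 0) (f c 0)) =
        univ.filter fun c => R (f a 0) (f c 0) := by
      ext c
      simp only [mem_filter, mem_univ, true_and, shift_of_mem hf hQ hR (hf.zero a)]
      exact ⟨fun h => h.elim (fun h => hR.le h) fun h => h, Or.inr⟩
    rw [heq]
    have hle : (univ.filter fun c => Q (f a 0) (f c 0)).card ≤
        (univ.filter fun c => R (f a 0) (f c 0)).card :=
      Finset.card_le_card fun c hc => by
        simp only [mem_filter, mem_univ, true_and] at hc ⊢
        exact hR.le hc
    obtain ⟨i, rfl⟩ : ∃ j, i = j + 1 := ⟨i - 1, by omega⟩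
    rcases (shift_leg hf hQ hR (by omega)).1 h with h | ⟨-, ha, hb, h⟩
    · exact (hQ.size _ a b hi hi' h hab).trans hle
    have hlt := card_lt_of_moved hR ha
    rcases Nat.eq_zero_or_pos i with rfl | hpos
    · have : ({a, b} : Finset ι).card ≤ (univ.filter fun c => R (f a 0) (f c 0)).card := by
        refine Finset.card_le_card fun c hc => ?_
        simp only [mem_insert, mem_singleton] at hc
        simp only [mem_filter, mem_univ, true_and]
        rcases hc with rfl | rfl
        · exact R.refl' _
        · exact h
      rwa [Finset.card_pair hab] at this
    · obtain ⟨j, rfl⟩ : ∃ j, i = j + 1 := ⟨i - 1, by omega⟩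
      have := hQ.size (j + 1) a b hpos (by omega) (hR.of_leg hf (by omega) h) hab
      omega

/-- One merging step inside `H` leads from a tidy partition to a tidy partition. -/
theorem Reach.shift_zero {w : ℕ} (hr : Reach G (max (w + 1) 4) Q)
    (hn : ∀ Q' : Setoid V, (∀ x ∈ HV, ∀ y ∈ HV, Q x y → Q' x y) →
      (∀ x ∈ HV, ∀ y ∈ HV, Q' x y → R x y) → Narrow (G.induce HV) Q' w) :
    Reach G (max (w + 1) 4) (shift hf hQ hR 0) := by
  suffices h : ∀ j ≤ N + 1, Reach G (max (w + 1) 4) (shift hf hQ hR (N + 1 - j)) by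
    simpa using h (N + 1) le_rfl
  intro j hj
  induction j with
  | zero =>
    have : shift hf hQ hR (N + 1 - 0) = Q := by
      ext x y
      rw [shift_apply]
      refine ⟨?_, Or.inl⟩
      rintro (h | h | ⟨i, a, b, h1, h2, -⟩)
      · exact h
      · omega
      · omega
    rwa [this]
  | succ j ih =>
    have hs : N + 1 - j = (N + 1 - (j + 1)) + 1 := by omega
    have ih := ih (by omega)
    rw [hs] at ih
    refine ih.of_le (shift_succ_le hf hQ hR _) fun Q' h1 h2 => ?_
    refine (shift_between_thin hf hQ hR h1 h2).narrow hf (hn Q' ?_ ?_)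
    · exact fun x _ y _ h => h1 (Or.inl h)
    · intro x hx y _ h
      rcases (shift_of_mem hf hQ hR hx).1 (h2 h) with h | h
      · exact hR.le h
      · exact h.2

end

end Trigraph

namespace Trigraph

variable {V : Type u} {G : Trigraph V} {HV : Finset V} {N : ℕ} {ι : Type u} [Fintype ι]
  {f : ι → ℕ → V}

theorem reach_bot (hf : Legs G HV N f) {w : ℕ} (hw : (G.induce HV).maxRedDeg ≤ w) :
    Reach G (max (w + 1) 4) (⊥ : Setoid V) := by
  have hnil : ∀ K : Trigraph V, Realizes K [] (⊥ : Setoid V) := fun K =>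
    ⟨trivial, fun x _ y _ => Iff.rfl⟩
  refine ⟨[], hnil G, (seqWidth_le_iff _ _ _).2 fun j hj => ?_⟩
  rw [List.take_nil]
  exact ((hnil G).maxRedDeg_le_iff _).2 (((tidyPart_bot hf).thin hf).narrow hf
    (((hnil (G.induce HV)).maxRedDeg_le_iff w).1 hw))

/-- Every contraction sequence of `H` can be followed by tidy partitions of `G`. -/
theorem exists_tidyPart (hf : Legs G HV N f) {w : ℕ} {psH : List (V × V)}
    (hv : ValidSteps (G.induce HV) psH) (hw : (G.induce HV).seqWidth psH ≤ w) :
    ∃ Q : Setoid V, TidyPart HV N f Q ∧ Reach G (max (w + 1) 4) Q ∧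
      ∀ x ∈ HV, ∀ y ∈ HV, Q x y ↔ collapse psH x = collapse psH y := by
  have hK : ∀ x, x ∈ (G.induce HV).verts ↔ x ∈ HV := fun x => by
    simp only [induce, mem_inter]
    exact ⟨fun h => h.2, fun h => ⟨hf.sub h, h⟩⟩
  induction psH using List.reverseRecOn with
  | nil =>
    exact ⟨⊥, tidyPart_bot hf, reach_bot hf ((seqWidth_le_iff _ _ _).1 hw 0 le_rfl),
      fun x _ y _ => Iff.rfl⟩
  | append_singleton ps p ih =>
    have narrow_ker : ∀ qs : List (V × V), ValidSteps (G.induce HV) qs →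
        (G.induce HV).seqWidth qs ≤ w → Narrow (G.induce HV) (Setoid.ker (collapse qs)) w := by
      intro qs hq hqw
      have hr : Realizes (G.induce HV) qs (Setoid.ker (collapse qs)) :=
        ⟨hq, fun x _ y _ => Setoid.ker_def.symm⟩
      refine (hr.maxRedDeg_le_iff w).1 ?_
      have := (seqWidth_le_iff _ _ _).1 hqw qs.length le_rfl
      rwa [List.take_length] at this
    have hn' := narrow_ker _ hv hw
    have hv' := (validSteps_append _ _ _).1 hv
    have hw' : (G.induce HV).seqWidth ps ≤ w := by
      rw [seqWidth_le_iff] at hw ⊢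
      intro j hj
      have := hw j (by simp; omega)
      rwa [List.take_append_of_le_length hj] at this
    have hn := narrow_ker _ hv'.1 hw'
    obtain ⟨Q, hQ, hr, hQH⟩ := ih hv'.1 hw'
    obtain ⟨hne, h1, h2⟩ := hv'.2
    rw [stage_verts hv'.1] at h1 h2
    obtain ⟨u, hu, hu'⟩ := Finset.mem_image.1 h1
    obtain ⟨v, hv, hv''⟩ := Finset.mem_image.1 h2
    rw [hK] at hu hv
    have huv : ¬ Q u v := fun h => hne (by rw [← hu', ← hv'']; exact (hQH u hu v hv).1 h)
    have hR : Merges HV Q (glue Q u v) := by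
      refine ⟨fun h => Or.inl h, ?_, ?_⟩
      · rintro x y (h | ⟨h1, h2⟩ | ⟨h1, h2⟩)
        · exact Or.inl h
        · exact Or.inr ⟨(hQ.leveled.mem_iff hf h1).2 hu, (hQ.leveled.mem_iff hf h2).2 hv⟩
        · exact Or.inr ⟨(hQ.leveled.mem_iff hf h1).2 hv, (hQ.leveled.mem_iff hf h2).2 hu⟩
      · intro x y z
        have t := @Q.trans'
        have s := @Q.symm'
        simp only [glue_apply]
        grind
    have hglue : ∀ x ∈ HV, ∀ y ∈ HV,
        glue Q u v x y ↔ collapse (ps ++ [p]) x = collapse (ps ++ [p]) y := by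
      intro x hx y hy
      rw [glue_apply, hQH x hx y hy, hQH x hx u hu, hQH x hx v hv, hQH y hy u hu, hQH y hy v hv,
        collapse_append, collapse_append, hu', hv'']
      simp only [mergeInto]
      grind
    refine ⟨shift hf hQ hR 0, shift_zero_tidyPart hf hQ hR, ?_, ?_⟩
    · refine Reach.shift_zero hf hQ hR hr fun Q' hQ1 hQ2 => ?_
      by_cases h : Q' u v
      · refine hn'.congr fun x hx y hy => ?_
        rw [hK] at hx hy
        rw [Setoid.ker_def, ← hglue x hx y hy]
        refine ⟨?_, hQ2 x hx y hy⟩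
        rintro (h' | ⟨h1, h2⟩ | ⟨h1, h2⟩)
        · exact hQ1 x hx y hy h'
        · exact Q'.trans' (hQ1 _ hx _ hu h1) (Q'.trans' h (Q'.symm' (hQ1 _ hy _ hv h2)))
        · exact Q'.trans' (hQ1 _ hx _ hv h1)
            (Q'.trans' (Q'.symm' h) (Q'.symm' (hQ1 _ hy _ hu h2)))
      · refine hn.congr fun x hx y hy => ?_
        rw [hK] at hx hy
        rw [Setoid.ker_def, ← hQH x hx y hy]
        refine ⟨hQ1 x hx y hy, fun h' => ?_⟩
        rcases hQ2 x hx y hy h' with h'' | ⟨h1, h2⟩ | ⟨h1, h2⟩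
        · exact h''
        · exact absurd (Q'.trans' (Q'.symm' (hQ1 _ hx _ hu h1))
            (Q'.trans' h' (hQ1 _ hy _ hv h2))) h
        · exact absurd (Q'.trans' (Q'.symm' (hQ1 _ hy _ hu h2))
            (Q'.trans' (Q'.symm' h') (hQ1 _ hx _ hv h1))) h
    · intro x hx y hy
      rw [shift_of_mem hf hQ hR hx, ← hglue x hx y hy]
      exact ⟨fun h => h.elim Or.inl fun h => h.2, fun h => Or.inr ⟨rfl, h⟩⟩

/-- A graph is acyclic if its vertices can be assigned heights so that every vertex has at most
one neighbor that is not higher. -/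
theorem isAcyclic_of_height {Γ : SimpleGraph V} (ht : V → ℕ)
    (h : ∀ x y z, Γ.Adj x y → Γ.Adj x z → ht y ≤ ht x → ht z ≤ ht x → y = z) :
    Γ.IsAcyclic := by
  intro v c hc
  obtain ⟨x, hx, hmax⟩ := Finset.exists_max_image c.support.toFinset ht
    ⟨v, by simp⟩
  simp only [List.mem_toFinset] at hx hmax
  have hc' := hc.rotate hx
  have hm : ∀ y ∈ (c.rotate x hx).support, ht y ≤ ht x := by
    intro y hy
    exact hmax y ((SimpleGraph.Walk.mem_support_rotate_iff c x hx).1 hy)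
  refine hc'.snd_ne_penultimate (h x _ _ ?_ ?_ ?_ ?_)
  · exact (c.rotate x hx).adj_snd hc'.not_nil
  · exact ((c.rotate x hx).adj_penultimate hc'.not_nil).symm
  · exact hm _ (SimpleGraph.Walk.getVert_mem_support _ _)
  · exact hm _ (SimpleGraph.Walk.getVert_mem_support _ _)

theorem Leveled.level_eq {Q : Setoid V} (hQ : Leveled HV N f Q) (hf : Legs G HV N f)
    {i j : ℕ} {a b : ι} (hi : i ≤ N + 1) (hj : j ≤ N + 1) (h : Q (f a i) (f b j)) : i = j := by
  rcases Nat.eq_zero_or_pos i with rfl | hi0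
  · by_contra h0
    obtain ⟨j, rfl⟩ : ∃ k, j = k + 1 := ⟨j - 1, by omega⟩
    exact (hf.mem b j (by omega)).2 ((hQ.mem_iff hf h).1 (hf.zero a))
  · obtain ⟨i, rfl⟩ : ∃ k, i = k + 1 := ⟨i - 1, by omega⟩
    obtain ⟨c, hc⟩ := hQ.exists_eq hf (by omega) h
    exact (hf.inj hj hi hc).2.symm

end Trigraph

namespace Trigraph

variable {V : Type u} {G : Trigraph V} {HV : Finset V} {m : ℕ} {ι : Type u} [Fintype ι]
  {f : ι → ℕ → V} {Q : Setoid V} {ps : List (V × V)}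

theorem Realizes.mem_bag (hR : Realizes G ps Q) {x y : V} (hx : x ∈ G.verts) :
    y ∈ bag G ps (collapse ps x) ↔ y ∈ G.verts ∧ Q x y := by
  rw [bag, Finset.mem_filter]
  refine and_congr_right fun hy => ?_
  rw [hR.2 y hy x hx]
  exact ⟨fun h => Q.symm' h, fun h => Q.symm' h⟩

theorem Realizes.mem_stage (hR : Realizes G ps Q) {u : V} :
    u ∈ (stage G ps).verts ↔ ∃ x ∈ G.verts, u = collapse ps x := by
  rw [stage_verts hR.1, Finset.mem_image]
  simp only [eq_comm]

/-- The vertices of the legs are those at distance at most `2m` from `H`, and their distance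
is their position on the leg. -/
structure LegsDist (G : Trigraph V) (HV : Finset V) (m : ℕ) (f : ι → ℕ → V) : Prop where
  dist : ∀ a i, i < 2 * m → G.distToSet HV (f a (i + 1)) = i + 1
  mem_Fverts : ∀ x, x ∈ Fverts G HV m ↔ ∃ a i, i < 2 * m ∧ x = f a (i + 1)

theorem mem_Fpart (hf : Legs G HV (2 * m) f) (hd : LegsDist G HV m f)
    (hQ : TidyPart HV (2 * m) f Q) (hR : Realizes G ps Q) {u : V} :
    u ∈ Fpart G HV m ps ↔ ∃ a i, i < 2 * m ∧ u = collapse ps (f a (i + 1)) := by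
  rw [Fpart, Finset.mem_filter, hR.mem_stage]
  constructor
  · rintro ⟨⟨x, hx, rfl⟩, hb⟩
    obtain ⟨a, i, hi, rfl⟩ := (hd.mem_Fverts x).1 (hb ((hR.mem_bag hx).2 ⟨hx, Q.refl' x⟩))
    exact ⟨a, i, hi, rfl⟩
  · rintro ⟨a, i, hi, rfl⟩
    have hx := (hf.mem a i hi.le).1
    refine ⟨⟨_, hx, rfl⟩, fun y hy => ?_⟩
    obtain ⟨b, rfl⟩ := hQ.leveled.exists_eq hf hi.le ((hR.mem_bag hx).1 hy).2
    exact (hd.mem_Fverts _).2 ⟨b, i, hi, rfl⟩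

theorem mem_Hpart (hf : Legs G HV (2 * m) f)
    (hQ : TidyPart HV (2 * m) f Q) (hR : Realizes G ps Q) {u : V} :
    u ∈ Hpart G HV ps ↔ ∃ x ∈ HV, u = collapse ps x := by
  rw [Hpart, Finset.mem_filter, hR.mem_stage]
  constructor
  · rintro ⟨⟨x, hx, rfl⟩, hb⟩
    exact ⟨x, hb ((hR.mem_bag hx).2 ⟨hx, Q.refl' x⟩), rfl⟩
  · rintro ⟨x, hx, rfl⟩
    refine ⟨⟨x, hf.sub hx, rfl⟩, fun y hy => ?_⟩
    exact (hQ.leveled.mem_iff hf ((hR.mem_bag (hf.sub hx)).1 hy).2).1 hx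

theorem mem_verts_of_legs (hf : Legs G HV (2 * m) f) {a : ι} {i : ℕ} (hi : i ≤ 2 * m + 1) :
    f a i ∈ G.verts := by
  rcases i with - | i
  · exact hf.sub (hf.zero a)
  · exact (hf.mem a i (by omega)).1

theorem collapse_legs (hf : Legs G HV (2 * m) f) (hR : Realizes G ps Q) {a b : ι} {i j : ℕ}
    (hi : i ≤ 2 * m + 1) (hj : j ≤ 2 * m + 1) :
    collapse ps (f a i) = collapse ps (f b j) ↔ Q (f a i) (f b j) :=
  hR.2 _ (mem_verts_of_legs hf hi) _ (mem_verts_of_legs hf hj)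

theorem collapse_legs_level (hf : Legs G HV (2 * m) f) (hQ : TidyPart HV (2 * m) f Q)
    (hR : Realizes G ps Q) {a b : ι} {i j : ℕ} (hi : i ≤ 2 * m + 1) (hj : j ≤ 2 * m + 1)
    (h : collapse ps (f a i) = collapse ps (f b j)) : i = j :=
  hQ.leveled.level_eq hf hi hj ((collapse_legs hf hR hi hj).1 h)

theorem level_collapse (hf : Legs G HV (2 * m) f) (hd : LegsDist G HV m f)
    (hQ : TidyPart HV (2 * m) f Q) (hR : Realizes G ps Q) (a : ι) {i : ℕ} (hi : i < 2 * m) :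
    level G HV ps (collapse ps (f a (i + 1))) = i + 1 := by
  have hx := (hf.mem a i hi.le).1
  have : {d | ∃ x ∈ bag G ps (collapse ps (f a (i + 1))), G.distToSet HV x = d} = {i + 1} := by
    ext d
    constructor
    · rintro ⟨x, hxb, rfl⟩
      obtain ⟨b, rfl⟩ := hQ.leveled.exists_eq hf hi.le ((hR.mem_bag hx).1 hxb).2
      exact hd.dist b i hi
    · rintro rfl
      exact ⟨_, (hR.mem_bag hx).2 ⟨hx, Q.refl' _⟩, hd.dist a i hi⟩
  rw [level, this, csInf_singleton]

theorem stage_adj_legs (hf : Legs G HV (2 * m) f) (hQ : TidyPart HV (2 * m) f Q)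
    (hR : Realizes G ps Q) (a : ι) {i : ℕ} (hi : i < 2 * m) {w : V} :
    (stage G ps).Adj (collapse ps (f a (i + 1))) w ↔ w = collapse ps (f a i) ∨
      ∃ b, Q (f a (i + 1)) (f b (i + 1)) ∧ w = collapse ps (f b (i + 2)) := by
  have hx := (hf.mem a i hi.le).1
  constructor
  · intro h
    obtain ⟨y, hy, rfl⟩ := hR.mem_stage.1 h.right_mem
    obtain ⟨x', hx', y', hy', h1, h2, h3⟩ := (stage_adj hR.1 hx hy h.ne).1 h
    have h1' := Q.symm' ((hR.2 _ hx' _ hx).1 h1)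
    obtain ⟨k, rfl⟩ := hQ.leveled.exists_eq hf hi.le h1'
    rcases (hf.adj k i y' hi).1 h3 with rfl | rfl
    · left
      rw [← h2, collapse_legs hf hR (by omega) (by omega)]
      exact Q.symm' (hQ.down i a k hi h1')
    · exact Or.inr ⟨k, h1', h2.symm⟩
  · have key : ∀ b j, j ≤ 2 * m + 1 → j ≠ i + 1 → Q (f a (i + 1)) (f b (i + 1)) →
        G.Adj (f b (i + 1)) (f b j) →
        (stage G ps).Adj (collapse ps (f a (i + 1))) (collapse ps (f b j)) := by
      intro b j hj hne hb hadj
      refine (stage_adj hR.1 hx (mem_verts_of_legs hf hj) fun h => hne ?_).2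
        ⟨_, hadj.left_mem, _, hadj.right_mem, ?_, rfl, hadj⟩
      · exact (collapse_legs_level hf hQ hR (by omega) hj h).symm
      · exact (collapse_legs hf hR (by omega) (by omega)).2 (Q.symm' hb)
    rintro (rfl | ⟨b, hb, rfl⟩)
    · exact key a i (by omega) (by omega) (Q.refl' _) ((hf.adj a i _ hi).2 (Or.inl rfl))
    · exact key b (i + 2) (by omega) (by omega) hb ((hf.adj b i _ hi).2 (Or.inr rfl))

theorem stage_deg_le (hf : Legs G HV (2 * m) f) (hQ : TidyPart HV (2 * m) f Q)
    (hR : Realizes G ps Q) (a : ι) {i : ℕ} (hi : i < 2 * m) :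
    (stage G ps).deg (collapse ps (f a (i + 1))) ≤ 3 := by
  obtain ⟨b, c, hb, hc, hbc⟩ := exists_pair (E := Q) (g := fun d => f d (i + 2))
    (C := fun d => Q (f a (i + 1)) (f d (i + 1))) (a := a) (Q.refl' _)
    (fun b c hb hc => hQ.split (i + 1) a b c (by omega) (by omega) hb hc)
  refine (deg_le_card {collapse ps (f a i), collapse ps (f b (i + 2)), collapse ps (f c (i + 2))}
    fun y hy => ?_).trans Finset.card_le_three
  simp only [Finset.mem_insert, Finset.mem_singleton]
  rcases (stage_adj_legs hf hQ hR a hi).1 hy with rfl | ⟨d, hd, rfl⟩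
  · exact Or.inl rfl
  · right
    rw [collapse_legs hf hR (by omega) (by omega), collapse_legs hf hR (by omega) (by omega)]
    exact hbc d hd

theorem stage_deg_eq_three_iff (hf : Legs G HV (2 * m) f) (hQ : TidyPart HV (2 * m) f Q)
    (hR : Realizes G ps Q) (a : ι) {i : ℕ} (hi : i < 2 * m) :
    (stage G ps).deg (collapse ps (f a (i + 1))) = 3 ↔
      ∃ b, Q (f a (i + 1)) (f b (i + 1)) ∧ ¬ Q (f a (i + 2)) (f b (i + 2)) := by
  constructor
  · intro h
    by_contra! hcon
    have : (stage G ps).deg (collapse ps (f a (i + 1))) ≤ 2 := by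
      refine (deg_le_card {collapse ps (f a i), collapse ps (f a (i + 2))}
        fun y hy => ?_).trans Finset.card_le_two
      simp only [Finset.mem_insert, Finset.mem_singleton]
      rcases (stage_adj_legs hf hQ hR a hi).1 hy with rfl | ⟨d, hd, rfl⟩
      · exact Or.inl rfl
      · right
        rw [collapse_legs hf hR (by omega) (by omega)]
        exact Q.symm' (hcon d hd)
    omega
  · rintro ⟨b, hb, hb'⟩
    refine le_antisymm (stage_deg_le hf hQ hR a hi) ?_
    have hcard : ({collapse ps (f a i), collapse ps (f a (i + 2)),
        collapse ps (f b (i + 2))} : Finset V).card = 3 := by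
      refine Finset.card_eq_three.2 ⟨_, _, _, fun h => ?_, fun h => ?_, fun h => ?_, rfl⟩
      · have := collapse_legs_level hf hQ hR (by omega) (by omega) h
        omega
      · have := collapse_legs_level hf hQ hR (by omega) (by omega) h
        omega
      · exact hb' ((collapse_legs hf hR (by omega) (by omega)).1 h)
    rw [← hcard]
    refine card_le_deg _ fun y hy => (stage_adj_legs hf hQ hR a hi).2 ?_
    simp only [Finset.mem_insert, Finset.mem_singleton] at hy
    rcases hy with rfl | rfl | rfl
    · exact Or.inl rfl
    · exact Or.inr ⟨a, Q.refl' _, rfl⟩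
    · exact Or.inr ⟨b, hb, rfl⟩

/-- The edges of the forest `F'`. -/
theorem Fpart_adj (hf : Legs G HV (2 * m) f) (hd : LegsDist G HV m f)
    (hQ : TidyPart HV (2 * m) f Q) (hR : Realizes G ps Q) (a : ι) {i : ℕ} (hi : i < 2 * m)
    {w : V} :
    ((stage G ps).induce (Fpart G HV m ps)).toSimple.Adj (collapse ps (f a (i + 1))) w ↔
      (0 < i ∧ w = collapse ps (f a i)) ∨
      ∃ b, i + 1 < 2 * m ∧ Q (f a (i + 1)) (f b (i + 1)) ∧ w = collapse ps (f b (i + 2)) := by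
  have hmem : ∀ b j, j ≤ 2 * m + 1 →
      (collapse ps (f b j) ∈ Fpart G HV m ps ↔ 0 < j ∧ j ≤ 2 * m) := by
    intro b j hj
    rw [mem_Fpart hf hd hQ hR]
    constructor
    · rintro ⟨c, k, hk, h⟩
      have := collapse_legs_level hf hQ hR hj (by omega) h
      omega
    · rintro ⟨h1, h2⟩
      exact ⟨b, j - 1, by omega, by rw [Nat.sub_add_cancel h1]⟩
  rw [toSimple_adj, induce_adj, stage_adj_legs hf hQ hR a hi, hmem a (i + 1) (by omega)]
  constructor
  · rintro ⟨rfl | ⟨b, hb, rfl⟩, -, hw⟩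
    · exact Or.inl ⟨((hmem _ _ (by omega)).1 hw).1, rfl⟩
    · exact Or.inr ⟨b, ((hmem _ _ (by omega)).1 hw).2, hb, rfl⟩
  · rintro (⟨h0, rfl⟩ | ⟨b, h0, hb, rfl⟩)
    · exact ⟨Or.inl rfl, by omega, (hmem _ _ (by omega)).2 (by omega)⟩
    · exact ⟨Or.inr ⟨b, hb, rfl⟩, by omega, (hmem _ _ (by omega)).2 (by omega)⟩

theorem Fpart_isAcyclic (hf : Legs G HV (2 * m) f) (hd : LegsDist G HV m f)
    (hQ : TidyPart HV (2 * m) f Q) (hR : Realizes G ps Q) :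
    ((stage G ps).induce (Fpart G HV m ps)).toSimple.IsAcyclic := by
  refine isAcyclic_of_height (level G HV ps) fun x y z hxy hxz hy hz => ?_
  obtain ⟨a, i, hi, rfl⟩ := (mem_Fpart hf hd hQ hR).1 (induce_adj.1 (toSimple_adj.1 hxy)).2.1
  have key : ∀ w, ((stage G ps).induce (Fpart G HV m ps)).toSimple.Adj
      (collapse ps (f a (i + 1))) w →
      level G HV ps w ≤ level G HV ps (collapse ps (f a (i + 1))) → w = collapse ps (f a i) := by
    intro w hw hl
    rcases (Fpart_adj hf hd hQ hR a hi).1 hw with h | ⟨b, h1, -, rfl⟩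
    · exact h.2
    · rw [level_collapse hf hd hQ hR a hi, level_collapse hf hd hQ hR b h1] at hl
      omega
  rw [key y hxy hy, key z hxz hz]

theorem mem_Fcomp (hf : Legs G HV (2 * m) f) (hd : LegsDist G HV m f)
    (hQ : TidyPart HV (2 * m) f Q) (hR : Realizes G ps Q) (a : ι) {i : ℕ} (hi : i < 2 * m)
    {w : V} :
    w ∈ Fcomp G HV m ps (collapse ps (f a (i + 1))) ↔
      ∃ b j, j < 2 * m ∧ w = collapse ps (f b (j + 1)) ∧ Q (f a 1) (f b 1) := by
  have hdown : ∀ b j, j < 2 * m → ((stage G ps).induce (Fpart G HV m ps)).toSimple.Reachable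
      (collapse ps (f b (j + 1))) (collapse ps (f b 1)) := by
    intro b j hj
    induction j with
    | zero => exact SimpleGraph.Reachable.refl _
    | succ j ih =>
      exact (((Fpart_adj hf hd hQ hR b hj).2
        (Or.inl ⟨Nat.succ_pos j, rfl⟩)).reachable).trans (ih (by omega))
  rw [Fcomp, Finset.mem_filter]
  constructor
  · rintro ⟨-, ⟨p⟩⟩
    have main : ∀ {u v : V}, ((stage G ps).induce (Fpart G HV m ps)).toSimple.Walk u v →
        (∃ b j, j < 2 * m ∧ u = collapse ps (f b (j + 1)) ∧ Q (f a 1) (f b 1)) →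
        ∃ b j, j < 2 * m ∧ v = collapse ps (f b (j + 1)) ∧ Q (f a 1) (f b 1) := by
      intro u v p
      induction p with
      | nil => exact id
      | cons h p ih =>
        rintro ⟨b, j, hj, rfl, hb⟩
        refine ih ?_
        rcases (Fpart_adj hf hd hQ hR b hj).1 h with ⟨h0, rfl⟩ | ⟨d, h1, h2, rfl⟩
        · exact ⟨b, j - 1, by omega, by rw [Nat.sub_add_cancel h0], hb⟩
        · exact ⟨d, j + 1, h1, rfl, Q.trans' hb
            (hQ.zero_one _ _ (hQ.down_zero (by omega) h2))⟩
    exact main p ⟨a, i, hi, rfl, Q.refl' _⟩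
  · rintro ⟨b, j, hj, rfl, hb⟩
    refine ⟨(mem_Fpart hf hd hQ hR).2 ⟨b, j, hj, rfl⟩, (hdown a i hi).trans ?_⟩
    rw [(collapse_legs hf hR (by omega) (by omega)).2 hb]
    exact (hdown b j hj).symm

theorem mem_Fcomp3 (hf : Legs G HV (2 * m) f) (hd : LegsDist G HV m f)
    (hQ : TidyPart HV (2 * m) f Q) (hR : Realizes G ps Q) (a : ι) {i : ℕ} (hi : i < 2 * m)
    {w : V} :
    w ∈ Fcomp3 G HV m ps (collapse ps (f a (i + 1))) ↔
      ∃ b j, j < 2 * m ∧ w = collapse ps (f b (j + 1)) ∧ Q (f a 1) (f b 1) ∧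
        ∃ d, Q (f b (j + 1)) (f d (j + 1)) ∧ ¬ Q (f b (j + 2)) (f d (j + 2)) := by
  rw [Fcomp3, Finset.mem_filter, mem_Fcomp hf hd hQ hR a hi]
  constructor
  · rintro ⟨⟨b, j, hj, rfl, hb⟩, h⟩
    exact ⟨b, j, hj, rfl, hb, (stage_deg_eq_three_iff hf hQ hR b hj).1 h⟩
  · rintro ⟨b, j, hj, rfl, hb, h⟩
    exact ⟨⟨b, j, hj, rfl, hb⟩, (stage_deg_eq_three_iff hf hQ hR b hj).2 h⟩

/-- The degree-3 vertices of a component of `F'` are connected to its root. -/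
theorem Fcomp3_reachable (hf : Legs G HV (2 * m) f) (hd : LegsDist G HV m f)
    (hQ : TidyPart HV (2 * m) f Q) (hR : Realizes G ps Q) (a : ι) {i : ℕ} (hi : i < 2 * m)
    {w : V} (hw : w ∈ Fcomp3 G HV m ps (collapse ps (f a (i + 1)))) :
    collapse ps (f a 1) ∈ Fcomp3 G HV m ps (collapse ps (f a (i + 1))) ∧
      ((stage G ps).induce (Fcomp3 G HV m ps (collapse ps (f a (i + 1))))).toSimple.Reachable
        w (collapse ps (f a 1)) := by
  obtain ⟨b, j, hj, rfl, hb, d, hd1, hd2⟩ := (mem_Fcomp3 hf hd hQ hR a hi).1 hw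
  induction j generalizing d with
  | zero =>
    rw [(collapse_legs hf hR (by omega) (by omega)).2 hb]
    exact ⟨hw, SimpleGraph.Reachable.refl _⟩
  | succ j ih =>
    obtain ⟨c, hc1, hc2⟩ := hQ.parent (j + 1) b d (by omega) hj hd1 hd2
    have hmem := (mem_Fcomp3 hf hd hQ hR a hi).2 ⟨b, j, by omega, rfl, hb, c, hc1, hc2⟩
    obtain ⟨h1, h2⟩ := ih (by omega) hmem c hc1 hc2
    refine ⟨h1, SimpleGraph.Reachable.trans (SimpleGraph.Adj.reachable ?_) h2⟩
    exact toSimple_adj.2 (induce_adj.2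
      ⟨(stage_adj_legs hf hQ hR b hj).2 (Or.inl rfl), hw, hmem⟩)

theorem TidyPart.isGTidy (hf : Legs G HV (2 * m) f) (hd : LegsDist G HV m f)
    (hQ : TidyPart HV (2 * m) f Q) (hR : Realizes G ps Q) : IsGTidy G HV m ps where
  valid := hR.1
  basic u hu := by
    obtain ⟨x, hx, rfl⟩ := hR.mem_stage.1 hu
    rw [mem_Hpart hf hQ hR, mem_Fpart hf hd hQ hR]
    by_cases hxH : x ∈ HV
    · exact Or.inl ⟨x, hxH, rfl⟩
    by_cases hleg : ∃ a i, i < 2 * m ∧ x = f a (i + 1)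
    · obtain ⟨a, i, hi, rfl⟩ := hleg
      exact Or.inr (Or.inl ⟨a, i, hi, rfl⟩)
    refine Or.inr (Or.inr (Finset.card_eq_one.2 ⟨x, ?_⟩))
    ext y
    rw [hR.mem_bag hx, Finset.mem_singleton]
    constructor
    · rintro ⟨-, h⟩
      rcases hQ.leveled _ _ h with h | h | ⟨i, a, b, hi, h, -⟩
      · exact h.symm
      · exact absurd h.1 hxH
      · exact absurd ⟨a, i, hi, h⟩ hleg
    · rintro rfl
      exact ⟨hx, Q.refl' _⟩
  outs u hu := by
    obtain ⟨x, hx, rfl⟩ := (mem_Hpart hf hQ hR).1 hu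
    have key : ∀ v ∈ ((stage G ps).verts \ Hpart G HV ps).filter
        (fun v => (stage G ps).Adj (collapse ps x) v),
        ∃ a, Q (f a 0) x ∧ v = collapse ps (f a 1) := by
      intro v hv
      rw [Finset.mem_filter, Finset.mem_sdiff, hR.mem_stage, mem_Hpart hf hQ hR] at hv
      obtain ⟨⟨⟨y, hy, rfl⟩, hyH⟩, hadj⟩ := hv
      obtain ⟨x', hx', y', hy', h1, h2, h3⟩ := (stage_adj hR.1 (hf.sub hx) hy hadj.ne).1 hadj
      have h1' := (hR.2 _ hx' _ (hf.sub hx)).1 h1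
      obtain ⟨a, rfl, rfl⟩ := hf.out ((hQ.leveled.mem_iff hf h1').2 hx)
        (fun h => hyH ⟨_, h, h2.symm⟩) h3
      exact ⟨a, h1', h2.symm⟩
    refine Finset.card_le_one.2 fun v hv v' hv' => ?_
    obtain ⟨a, ha, rfl⟩ := key v hv
    obtain ⟨b, hb, rfl⟩ := key v' hv'
    rw [collapse_legs hf hR (by omega) (by omega)]
    exact hQ.zero_one _ _ (Q.trans' ha (Q.symm' hb))
  levels u hu x hx y hy := by
    obtain ⟨a, i, hi, rfl⟩ := (mem_Fpart hf hd hQ hR).1 hu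
    have key : ∀ z ∈ bag G ps (collapse ps (f a (i + 1))), G.distToSet HV z = i + 1 := by
      intro z hz
      obtain ⟨b, rfl⟩ := hQ.leveled.exists_eq hf hi.le
        ((hR.mem_bag (hf.mem a i hi.le).1).1 hz).2
      exact hd.dist b i hi
    rw [key x hx, key y hy]
  forest := Fpart_isAcyclic hf hd hQ hR
  deg_le u hu := by
    obtain ⟨a, i, hi, rfl⟩ := (mem_Fpart hf hd hQ hR).1 hu
    exact stage_deg_le hf hQ hR a hi
  comp_cond u hu := by
    obtain ⟨a, i, hi, rfl⟩ := (mem_Fpart hf hd hQ hR).1 hu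
    have h0 : 0 < 2 * m := by omega
    refine ⟨collapse ps (f a 1), (mem_Fcomp hf hd hQ hR a hi).2 ⟨a, 0, h0, rfl, Q.refl' _⟩,
      level_collapse hf hd hQ hR a h0, ?_, ?_, ?_, ?_⟩
    · intro r hr hl
      obtain ⟨b, j, hj, rfl, hb⟩ := (mem_Fcomp hf hd hQ hR a hi).1 hr
      rw [level_collapse hf hd hQ hR b hj] at hl
      obtain rfl : j = 0 := by omega
      exact (collapse_legs hf hR (by omega) (by omega)).2 (Q.symm' hb)
    · intro v hv w hw
      exact (Fcomp3_reachable hf hd hQ hR a hi hv).2.trans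
        (Fcomp3_reachable hf hd hQ hR a hi hw).2.symm
    · intro w hw
      obtain ⟨b, j, hj, rfl, hb, d, hd1, hd2⟩ := (mem_Fcomp3 hf hd hQ hR a hi).1 hw
      rw [level_collapse hf hd hQ hR b hj]
      have hne : b ≠ d := by
        rintro rfl
        exact hd2 (Q.refl' _)
      have hsize := hQ.size (j + 1) b d (by omega) (by omega) hd1 hne
      have hle : (univ.filter fun c => Q (f b 0) (f c 0)).card ≤
          (bag G ps (collapse ps (f a 1))).card := by
        refine Finset.card_le_card_of_injOn (fun c => f c 1) (fun c hc => ?_) fun c _ c' _ h =>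
          (hf.inj (by omega) (by omega) h).1
        have hc' : Q (f b 0) (f c 0) := by simpa using hc
        exact (hR.mem_bag (mem_verts_of_legs hf (by omega))).2
          ⟨mem_verts_of_legs hf (by omega), Q.trans' hb (hQ.zero_one _ _ hc')⟩
      omega
    · rcases (Fcomp3 G HV m ps (collapse ps (f a (i + 1)))).eq_empty_or_nonempty with h | ⟨w, hw⟩
      · exact Or.inl h
      · exact Or.inr (Fcomp3_reachable hf hd hQ hR a hi hw).1

end Trigraph

namespace Trigraph

variable {V : Type u} {G : Trigraph V} {HV : Finset V} {m : ℕ} {ι : Type u} [Fintype ι]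
  {f : ι → ℕ → V}

/-- A walk of length at most `N` ending in `H` starts in `H` or on a leg. -/
theorem Legs.mem_or_exists_of_walk {N : ℕ} (hf : Legs G HV N f) {x y : V}
    (p : G.toSimple.Walk x y) (hy : y ∈ HV) (hp : p.length ≤ N) :
    x ∈ HV ∨ ∃ a i, i + 1 ≤ p.length ∧ x = f a (i + 1) := by
  induction p with
  | nil => exact Or.inl hy
  | cons h p ih =>
    rename_i u v w
    rw [SimpleGraph.Walk.length_cons] at hp ⊢
    have h' : G.Adj v u := (toSimple_adj.1 h).symm
    by_cases hu : u ∈ HV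
    · exact Or.inl hu
    right
    rcases ih hy (by omega) with hv | ⟨a, i, hi, rfl⟩
    · obtain ⟨a, -, rfl⟩ := hf.out hv hu h'
      exact ⟨a, 0, by omega, rfl⟩
    · rcases (hf.adj a i u (by omega)).1 h' with rfl | rfl
      · rcases i with - | i
        · exact absurd (hf.zero a) hu
        · exact ⟨a, i, by omega, rfl⟩
      · exact ⟨a, i + 1, by omega, rfl⟩

theorem Legs.exists_walk {N : ℕ} (hf : Legs G HV N f) (a : ι) {i : ℕ} (hi : i ≤ N) :
    ∃ p : G.toSimple.Walk (f a i) (f a 0), p.length = i := by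
  induction i with
  | zero => exact ⟨SimpleGraph.Walk.nil, rfl⟩
  | succ i ih =>
    obtain ⟨p, hp⟩ := ih (by omega)
    exact ⟨SimpleGraph.Walk.cons (toSimple_adj.2 ((hf.adj a i _ (by omega)).2 (Or.inl rfl))) p,
      by rw [SimpleGraph.Walk.length_cons, hp]⟩

theorem distToSet_le {x y : V} (p : G.toSimple.Walk x y) (hy : y ∈ HV) :
    G.distToSet HV x ≤ p.length := by
  have h : G.toSimple.dist x y ∈ {d | ∃ a ∈ HV, G.toSimple.dist x a = d} := ⟨y, hy, rfl⟩
  exact (Nat.sInf_le h).trans (SimpleGraph.dist_le p)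

theorem exists_walk_length_eq_distToSet (hG : G.Conn) (hsub : HV ⊆ G.verts)
    (hne : HV.Nonempty) {x : V} (hx : x ∈ G.verts) :
    ∃ y ∈ HV, ∃ p : G.toSimple.Walk x y, p.length = G.distToSet HV x := by
  obtain ⟨z, hz⟩ := hne
  have hS : ({d | ∃ a ∈ HV, G.toSimple.dist x a = d} : Set ℕ).Nonempty := ⟨_, z, hz, rfl⟩
  obtain ⟨y, hy, hd⟩ := Nat.sInf_mem hS
  obtain ⟨p, hp⟩ := (hG.2 x hx y (hsub hy)).exists_walk_length_eq_dist
  exact ⟨y, hy, p, hp.trans hd⟩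

theorem Legs.legsDist (hf : Legs G HV (2 * m) f) (hG : G.Conn) (hne : HV.Nonempty) :
    LegsDist G HV m f := by
  have hle : ∀ a i, i < 2 * m → G.distToSet HV (f a (i + 1)) ≤ i + 1 := by
    intro a i hi
    obtain ⟨p, hp⟩ := hf.exists_walk a (i := i + 1) (by omega)
    exact (distToSet_le p (hf.zero a)).trans hp.le
  refine ⟨fun a i hi => le_antisymm (hle a i hi) ?_, fun x => ?_⟩
  · obtain ⟨y, hy, p, hp⟩ := exists_walk_length_eq_distToSet hG hf.sub hne (hf.mem a i hi.le).1
    have := hle a i hi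
    rcases hf.mem_or_exists_of_walk p hy (by omega) with h | ⟨b, j, hj, h⟩
    · exact absurd h (hf.mem a i hi.le).2
    · have := (hf.inj (by omega) (by omega) h).2
      omega
  · rw [Fverts, Finset.mem_filter, Finset.mem_sdiff]
    constructor
    · rintro ⟨⟨hx, hxH⟩, hd⟩
      obtain ⟨y, hy, p, hp⟩ := exists_walk_length_eq_distToSet hG hf.sub hne hx
      rcases hf.mem_or_exists_of_walk p hy (by omega) with h | ⟨b, j, hj, h⟩
      · exact absurd h hxH
      · exact ⟨b, j, by omega, h⟩
    · rintro ⟨a, i, hi, rfl⟩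
      exact ⟨hf.mem a i hi.le, (hle a i hi).trans hi⟩

end Trigraph

namespace Trigraph

variable {V : Type u} {G : Trigraph V} {HV : Finset V} {P : Finset (List V)} {q : List V}

theorem adj_iff_of_deg_eq_two {x a b : V} (h : G.deg x = 2) (ha : G.Adj x a) (hb : G.Adj x b)
    (hab : a ≠ b) (y : V) : G.Adj x y ↔ y = a ∨ y = b := by
  obtain ⟨S, hS, hS'⟩ := G.exists_neighbors x
  have : ({a, b} : Finset V) = S := by
    refine Finset.eq_of_subset_of_card_le (fun z hz => ?_) ?_
    · rcases Finset.mem_insert.1 hz with rfl | hz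
      · exact (hS' _).2 ha
      · rw [Finset.mem_singleton.1 hz]
        exact (hS' _).2 hb
    · rw [hS, h, Finset.card_pair hab]
  rw [← hS', ← this, Finset.mem_insert, Finset.mem_singleton]

theorem exists_ne_adj_of_deg_eq_two {x : V} (h : G.deg x = 2) (a : V) :
    ∃ b, b ≠ a ∧ G.Adj x b := by
  obtain ⟨S, hS, hS'⟩ := G.exists_neighbors x
  obtain ⟨b, hb, hba⟩ := Finset.exists_mem_ne (by omega : 1 < S.card) a
  exact ⟨b, hba, (hS' b).1 hb⟩

theorem exists_getElem_of_pair {α : Type*} {l : List α} {x y : α} (h : [x, y] <:+: l) :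
    ∃ (i : ℕ) (hi : i + 1 < l.length), l[i] = x ∧ l[i + 1] = y := by
  obtain ⟨s, t, rfl⟩ := h
  refine ⟨s.length, ?_, ?_, ?_⟩
  · simp
  · simp
  · simp

/-- A dangling red path outside `H` whose vertices have no neighbors other than vertices of `H`
and their predecessors and successors on the path. -/
structure IsolatedPath (G : Trigraph V) (HV : Finset V) (q : List V) : Prop where
  nodup : q.Nodup
  red : ∀ i (h : i + 1 < q.length), G.RedAdj q[i] q[i + 1]
  mem : ∀ x ∈ q, x ∈ G.verts ∧ G.deg x = 2 ∧ x ∉ HV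
  near : ∀ x ∈ q, ∀ y, G.Adj x y → y ∈ HV ∨ [x, y] <:+: q ∨ [y, x] <:+: q

theorem IsolatedPath.reverse (hq : IsolatedPath G HV q) : IsolatedPath G HV q.reverse where
  nodup := List.nodup_reverse.2 hq.nodup
  red i h := by
    rw [List.length_reverse] at h
    rw [List.getElem_reverse, List.getElem_reverse]
    have := (hq.red (q.length - 1 - (i + 1)) (by omega)).symm
    simpa only [show q.length - 1 - (i + 1) + 1 = q.length - 1 - i by omega] using this
  mem x hx := hq.mem x (List.mem_reverse.1 hx)
  near x hx y hy := by
    have key : ∀ a b : V, [a, b] <:+: q → [b, a] <:+: q.reverse := by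
      rintro a b ⟨s, t, rfl⟩
      exact ⟨t.reverse, s.reverse, by simp⟩
    rcases hq.near x (List.mem_reverse.1 hx) y hy with h | h | h
    · exact Or.inl h
    · exact Or.inr (Or.inr (key _ _ h))
    · exact Or.inr (Or.inl (key _ _ h))

theorem IsTidy.isolatedPath (ht : IsTidy G HV P) (hq : q ∈ P) : IsolatedPath G HV q where
  nodup := (ht.paths q hq).2.1
  red i h := by
    have := (ht.paths q hq).2.2.1
    exact List.isChain_iff_getElem.1 this i h
  mem x hx := ⟨((ht.paths q hq).2.2.2 x hx).1, ((ht.paths q hq).2.2.2 x hx).2, ht.Hdisj q hq x hx⟩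
  near x hx y hxy := by
    rcases ht.cover y hxy.right_mem with h | ⟨p, hp, hy⟩
    · exact Or.inl h
    · right
      obtain rfl : q = p := by
        by_contra hne
        exact ht.noPathPathEdges q hq p hp hne x hx y hy hxy
      exact ht.pathsInduced q hq x hx y hy hxy

theorem IsolatedPath.adj_inner (hq : IsolatedPath G HV q) {i : ℕ} (hi : i + 2 < q.length)
    (y : V) : G.Adj q[i + 1] y ↔ y = q[i] ∨ y = q[i + 2] := by
  refine adj_iff_of_deg_eq_two (hq.mem _ (List.getElem_mem _)).2.1
    (Or.inr (hq.red i (by omega)).symm) (Or.inr (hq.red (i + 1) hi)) (fun h => ?_) y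
  have := (hq.nodup.getElem_inj_iff).1 h
  omega

theorem IsolatedPath.exists_adj_first (hq : IsolatedPath G HV q) (hn : 1 < q.length) :
    ∃ u ∈ HV, ∀ y, G.Adj q[0] y ↔ y = u ∨ y = q[1] := by
  have hdeg := (hq.mem _ (List.getElem_mem (by omega : 0 < q.length))).2.1
  have h1 : G.Adj q[0] q[1] := Or.inr (hq.red 0 hn)
  obtain ⟨u, hu, hadj⟩ := exists_ne_adj_of_deg_eq_two hdeg q[1]
  refine ⟨u, ?_, adj_iff_of_deg_eq_two hdeg hadj h1 hu⟩
  rcases hq.near _ (List.getElem_mem _) u hadj with h | h | h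
  · exact h
  · obtain ⟨i, hi, h2, h3⟩ := exists_getElem_of_pair h
    obtain rfl := (hq.nodup.getElem_inj_iff).1 h2
    exact absurd h3.symm hu
  · obtain ⟨i, hi, -, h3⟩ := exists_getElem_of_pair h
    have := (hq.nodup.getElem_inj_iff).1 h3
    omega

/-- The paths of `𝒫` together with their reversals, one for each place where a path of `𝒫`
is attached to `H`. -/
noncomputable def orientedPaths (P : Finset (List V)) : Finset (List V) :=
  P ∪ P.image List.reverse

theorem mem_orientedPaths : q ∈ orientedPaths P ↔ q ∈ P ∨ q.reverse ∈ P := by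
  rw [orientedPaths, Finset.mem_union, Finset.mem_image]
  refine or_congr_right ⟨?_, fun h => ⟨_, h, List.reverse_reverse q⟩⟩
  rintro ⟨p, hp, rfl⟩
  rwa [List.reverse_reverse]

theorem card_orientedPaths_le (P : Finset (List V)) : (orientedPaths P).card ≤ 2 * P.card := by
  have h1 := Finset.card_union_le P (P.image List.reverse)
  have h2 := Finset.card_image_le (s := P) (f := List.reverse)
  rw [orientedPaths]
  omega

theorem IsTidy.isolatedPath_oriented (ht : IsTidy G HV P) (hq : q ∈ orientedPaths P) :
    IsolatedPath G HV q := by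
  rcases mem_orientedPaths.1 hq with h | h
  · exact ht.isolatedPath h
  · simpa using (ht.isolatedPath h).reverse

theorem exists_mem_path (hq : q ∈ orientedPaths P) {x : V} (hx : x ∈ q) :
    ∃ p ∈ P, x ∈ p ∧ (q = p ∨ q = p.reverse) := by
  rcases mem_orientedPaths.1 hq with h | h
  · exact ⟨q, h, hx, Or.inl rfl⟩
  · exact ⟨_, h, List.mem_reverse.2 hx, Or.inr (List.reverse_reverse q).symm⟩

theorem IsTidy.eq_or_eq_reverse (ht : IsTidy G HV P) {q' : List V} (hq : q ∈ orientedPaths P)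
    (hq' : q' ∈ orientedPaths P) {x : V} (hx : x ∈ q) (hx' : x ∈ q') :
    q = q' ∨ q = q'.reverse := by
  obtain ⟨p, hp, hxp, h⟩ := exists_mem_path hq hx
  obtain ⟨p', hp', hxp', h'⟩ := exists_mem_path hq' hx'
  obtain rfl : p = p' := by
    by_contra hne
    exact ht.pathsDisj p hp p' hp' hne x hxp hxp'
  rcases h with rfl | rfl <;> rcases h' with rfl | rfl <;> simp

theorem IsTidy.exists_legs (ht : IsTidy G HV P) (hlong : ∀ p ∈ P, 8 * P.card ≤ p.length) :
    ∃ f : orientedPaths P → ℕ → V, Legs G HV (2 * P.card) f := by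
  have hm : 0 < P.card := Finset.card_pos.2 ht.Pne
  have hlen : ∀ q ∈ orientedPaths P, 8 * P.card ≤ q.length := by
    intro q hq
    rcases mem_orientedPaths.1 hq with h | h
    · exact hlong q h
    · simpa using hlong _ h
  have hpath : ∀ a : orientedPaths P, IsolatedPath G HV a.1 := fun a =>
    ht.isolatedPath_oriented a.2
  have hlt : ∀ (a : orientedPaths P) (i : ℕ), i ≤ 2 * P.card + 1 → i < a.1.length :=
    fun a i hi => by
      have := hlen a.1 a.2
      omega
  choose u huH hu using fun a => (hpath a).exists_adj_first (hlt a 1 (by omega))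
  let f : orientedPaths P → ℕ → V := fun a i => i.casesOn (u a) fun k => a.1.getD k (u a)
  have hf : ∀ a i (hi : i ≤ 2 * P.card + 1), f a (i + 1) = a.1[i]'(hlt a i hi) := fun a i hi =>
    List.getD_eq_getElem _ _ _
  have honpath : ∀ (a : orientedPaths P) i (h : i < a.1.length), ∃ p ∈ P, a.1[i] ∈ p :=
    fun a i h => by
      obtain ⟨p, hp, h, -⟩ := exists_mem_path a.2 (List.getElem_mem h)
      exact ⟨p, hp, h⟩
  have hinj : ∀ (a b : orientedPaths P) i j (hi : i ≤ 2 * P.card + 1) (hj : j ≤ 2 * P.card + 1),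
      i + j ≤ 4 * P.card + 2 →
      a.1[i]'(hlt a i hi) = b.1[j]'(hlt b j hj) → a = b ∧ i = j := by
    intro a b i j hi hj hij h
    have hia := hlt a i hi
    rcases ht.eq_or_eq_reverse a.2 b.2 (List.getElem_mem (hlt a i hi))
      (h ▸ List.getElem_mem (hlt b j hj)) with hab | hab
    · obtain rfl := Subtype.ext hab
      exact ⟨rfl, ((hpath a).nodup.getElem_inj_iff).1 h⟩
    · simp only [hab, List.getElem_reverse] at h
      have := ((hpath b).nodup.getElem_inj_iff).1 h
      have := hlen b.1 b.2
      omega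
  have hzero : ∀ (a : orientedPaths P) x, x ∈ HV →
      G.Adj (a.1[0]'(hlt a 0 (by omega))) x → x = u a := by
    intro a x hx h
    refine ((hu a x).1 h).resolve_right ?_
    rintro rfl
    exact ((hpath a).mem _ (List.getElem_mem _)).2.2 hx
  refine ⟨f, ⟨by omega, ?_, ht.Hsub, ?_, huH, ?_, ?_, ?_, ?_⟩⟩
  · rw [Fintype.card_coe]
    exact card_orientedPaths_le P
  · intro a b i j hi hj h
    have hout : ∀ (c : orientedPaths P) k, k ≤ 2 * P.card → f c (k + 1) ∉ HV := by
      intro c k hk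
      rw [hf c k (by omega)]
      exact ((hpath c).mem _ (List.getElem_mem _)).2.2
    rcases i with - | i <;> rcases j with - | j
    · refine hinj a b 0 0 (by omega) (by omega) (by omega) ?_
      have h' : u a = u b := h
      have ha := ((hu a _).2 (Or.inl rfl)).symm
      have hb := ((hu b _).2 (Or.inl rfl)).symm
      rw [← h'] at hb
      exact (ht.boundary _ (huH a) _ (honpath b 0 _) hb).2 _ (honpath a 0 _) ha
    · exact absurd (h ▸ huH a) (hout b j (by omega))
    · exact absurd (h.symm ▸ huH b) (hout a i (by omega))
    · rw [hf a i (by omega), hf b j (by omega)] at h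
      obtain ⟨h1, rfl⟩ := hinj a b i j (by omega) (by omega) (by omega) h
      exact ⟨h1, rfl⟩
  · intro a i hi
    rw [hf a i (by omega)]
    have := (hpath a).mem _ (List.getElem_mem (hlt a i (by omega)))
    exact ⟨this.1, this.2.2⟩
  · intro a i y hi
    rcases i with - | i
    · rw [hf a 0 (by omega), hf a 1 (by omega)]
      exact hu a y
    · rw [hf a (i + 1) (by omega), hf a i (by omega), hf a (i + 2) (by omega)]
      exact (hpath a).adj_inner (hlt a (i + 2) (by omega)) y
  · intro x y hx hy hadj
    suffices h : ∃ a : orientedPaths P, y = a.1[0]'(hlt a 0 (by omega)) by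
      obtain ⟨a, rfl⟩ := h
      exact ⟨a, hzero a x hx hadj.symm, (hf a 0 (by omega)).symm⟩
    obtain ⟨p, hp, hyp⟩ := (ht.cover y hadj.right_mem).resolve_left hy
    obtain ⟨i, hi, rfl⟩ := List.getElem_of_mem hyp
    rcases i with - | i
    · exact ⟨⟨p, mem_orientedPaths.2 (Or.inl hp)⟩, rfl⟩
    · by_cases hi' : i + 2 < p.length
      · rcases ((ht.isolatedPath hp).adj_inner hi' x).1 hadj.symm with rfl | rfl <;>
          exact absurd hx ((ht.isolatedPath hp).mem _ (List.getElem_mem _)).2.2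
      · refine ⟨⟨p.reverse, mem_orientedPaths.2 (Or.inr (by simpa using hp))⟩, ?_⟩
        simp only [List.getElem_reverse]
        congr 1
        omega
  · intro x hx hxH
    obtain ⟨p, hp, hxp⟩ := (ht.cover x hx).resolve_left hxH
    obtain ⟨S, hS, hS'⟩ := G.exists_neighbors x
    rw [((ht.isolatedPath hp).mem x hxp).2.1] at hS
    obtain ⟨y, z, -, rfl⟩ := Finset.card_eq_two.1 hS
    exact ⟨y, z, fun w hw => by simpa using (hS' w).2 hw⟩

end Trigraph

/-- **Contracting a tidy `(H,𝒫)`-graph down to a `G`-tidy trigraph (Lemma 9).** Let `G` be a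
tidy `(H,𝒫)`-graph with `m = |𝒫|` in which every path of `𝒫` has at least `8m` vertices.
Given a contraction sequence `C_H` of `H`, there is a partial contraction sequence of `G` of
width at most `max(w(C_H) + 1, 4)` ending in a `G`-tidy trigraph whose part `H'` is a single
vertex. -/
theorem tidy_contract_to_GTidy {V : Type u} (G : Trigraph V) (HV : Finset V)
    (P : Finset (List V)) (ht : IsTidy G HV P)
    (hlong : ∀ p ∈ P, 8 * P.card ≤ p.length)
    (psH : List (V × V)) (hH : (G.induce HV).IsContractionSeq psH) :
    ∃ ps : List (V × V), ValidSteps G ps ∧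
      G.seqWidth ps ≤ max ((G.induce HV).seqWidth psH + 1) 4 ∧
      IsGTidy G HV P.card ps ∧ (Hpart G HV ps).card = 1 := by
  obtain ⟨f, hf⟩ := ht.exists_legs hlong
  have hK : (G.induce HV).verts = HV := Finset.inter_eq_right.2 ht.Hsub
  obtain ⟨u, hu⟩ := Finset.card_eq_one.1 hH.2
  rw [stage_verts hH.1, hK] at hu
  have hmem : ∀ x ∈ HV, collapse psH x = u := fun x hx => by
    simpa [hu] using Finset.mem_image_of_mem (collapse psH) hx
  have hne : HV.Nonempty := by
    rw [← Finset.image_nonempty (f := collapse psH), hu]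
    exact Finset.singleton_nonempty u
  obtain ⟨Q, hQ, ⟨ps, hR, hw⟩, hQH⟩ := exists_tidyPart hf hH.1 le_rfl
  refine ⟨ps, hR.1, hw, hQ.isGTidy hf (hf.legsDist ht.conn hne) hR, ?_⟩
  obtain ⟨x, hx⟩ := hne
  refine Finset.card_eq_one.2 ⟨collapse ps x, ?_⟩
  ext v
  rw [mem_Hpart hf hQ hR, Finset.mem_singleton]
  constructor
  · rintro ⟨y, hy, rfl⟩
    rw [hR.2 y (hf.sub hy) x (hf.sub hx), hQH y hy x hx, hmem y hy, hmem x hx]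
  · rintro rfl
    exact ⟨x, hx, rfl⟩
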